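/- arXiv:math/0001122 — 4 statements merged into one kernel-verified Lean document; each statement's English description precedes it below -/
import Mathlib

section
/- Let f be analytic on an open neighbourhood of 0 in ℂ with f(0) = 0, and for real t ≥ 0 write x(t) = Re f(t) and y(t) = Im f(t). Suppose that for every ε > 0 the function t ↦ x(t) is not identically zero on [0, ε), and that for every p ∈ ℕ one has y(t)/(x(t))^p → 0 as t → 0⁺ (through values of t with x(t) ≠ 0). Then there exists ε > 0 such that y(t) = 0 for all t ∈ [0, ε). In other words, an analytic arc through 0 that is not contained in the real axis can have only a finite order of contact with the real axis at 0. -/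
open Filter Set

/-- A real function analytic at `0` that is `o(t ^ n)` from the right for every `n` vanishes near
`0`. -/
theorem AnalyticAt.eventually_eq_zero_of_tendsto_div_pow {y : ℝ → ℝ} (hy : AnalyticAt ℝ y 0)
    (h : ∀ n : ℕ, Tendsto (fun t => y t / t ^ n) (nhdsWithin 0 (Ioi 0)) (nhds 0)) :
    ∀ᶠ t in nhds 0, y t = 0 := by
  by_contra hne
  obtain ⟨n, g, hg, hg0, hyg⟩ := hy.exists_eventuallyEq_pow_smul_nonzero_iff.mpr hne
  refine hg0 (tendsto_nhds_unique
    (hg.continuousAt.tendsto.mono_left nhdsWithin_le_nhds) ((h n).congr' ?_))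
  filter_upwards [nhdsWithin_le_nhds hyg, self_mem_nhdsWithin] with t ht ht0
  have ht0' : t ≠ 0 := ne_of_gt ht0
  rw [ht, sub_zero, smul_eq_mul]
  field_simp

/-- **Finite order of contact of an analytic arc (Remark 1 of the paper).**
Let `f` be analytic near `0` with `f 0 = 0`, write `x(t) = Re f(t)`,
`y(t) = Im f(t)` for real `t ≥ 0`. If `x` is not identically zero on any
interval `[0, ε)`, and for every `p ∈ ℕ` one has `y(t)/x(t)^p → 0` as
`t → 0⁺` through values with `x(t) ≠ 0`, then `y` vanishes identically on
some interval `[0, ε)`. -/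
theorem analytic_arc_finite_order_of_contact
    (f : ℂ → ℂ) (hf : AnalyticAt ℂ f 0) (hf0 : f 0 = 0)
    (hx : ∀ ε : ℝ, 0 < ε → ¬ ∀ t ∈ Set.Ico (0 : ℝ) ε, (f (t : ℂ)).re = 0)
    (hy : ∀ p : ℕ,
      Tendsto (fun t : ℝ => (f (t : ℂ)).im / ((f (t : ℂ)).re) ^ p)
        (nhdsWithin 0 (Set.Ioi 0 ∩ {t : ℝ | (f (t : ℂ)).re ≠ 0})) (nhds 0)) :
    ∃ ε : ℝ, 0 < ε ∧ ∀ t ∈ Set.Ico (0 : ℝ) ε, (f (t : ℂ)).im = 0 := by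
  have hX : AnalyticAt ℝ (fun t : ℝ => (f t).re) 0 :=
    AnalyticAt.re_ofReal (by simpa using hf)
  have hY : AnalyticAt ℝ (fun t : ℝ => (f t).im) 0 :=
    AnalyticAt.im_ofReal (by simpa using hf)
  have hXne : ∀ᶠ t : ℝ in nhdsWithin 0 (Ioi 0), (f t).re ≠ 0 := by
    rcases hX.eventually_eq_zero_or_eventually_ne_zero with h | h
    · obtain ⟨ε, hε, hball⟩ := Metric.eventually_nhds_iff.mp h
      refine absurd (fun t ht => hball ?_) (hx ε hε)
      simpa [abs_of_nonneg ht.1] using ht.2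
    · exact h.filter_mono (nhdsWithin_mono _ fun t ht => ne_of_gt ht)
  have hslope : Tendsto (fun t : ℝ => (f t).re / t) (nhdsWithin 0 (Ioi 0))
      (nhds (deriv (fun t : ℝ => (f t).re) 0)) := by
    have h := hX.differentiableAt.hasDerivAt.tendsto_slope.mono_left
      (nhdsWithin_mono 0 fun t (ht : t ∈ Ioi 0) => ne_of_gt ht)
    refine h.congr fun t => ?_
    simp [slope_def_field, hf0]
  have hzero : ∀ᶠ t : ℝ in nhds 0, (f t).im = 0 := by
    refine hY.eventually_eq_zero_of_tendsto_div_pow fun n => ?_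
    have hyn : Tendsto (fun t : ℝ => (f t).im / (f t).re ^ n) (nhdsWithin 0 (Ioi 0)) (nhds 0) :=
      (hy n).mono_left (le_inf nhdsWithin_le_nhds
        (le_principal_iff.mpr (inter_mem self_mem_nhdsWithin hXne)))
    have hmul := hyn.mul (hslope.pow n)
    rw [zero_mul] at hmul
    refine hmul.congr' ?_
    filter_upwards [hXne] with t ht
    rw [div_pow, div_mul_div_cancel₀ (pow_ne_zero n ht)]
  obtain ⟨ε, hε, hball⟩ := Metric.eventually_nhds_iff.mp hzero
  refine ⟨ε, hε, fun t ht => hball ?_⟩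
  simpa [abs_of_nonneg ht.1] using ht.2
end

section
/- Let G ⊂ ℂ be a Jordan domain with 0 ∈ ∂G and z₀ ∈ G, and let φ̂ : cl(G) → ℂ be a continuous function whose restriction to G is the normalized conformal map φ of G with respect to z₀. Suppose there exist R > 0, c₁ > 0 and p > 1 such that G ∩ {z : |z| < R} ⊆ {x + iy : x > 0, |y| < c₁ x^p}, and suppose ∂G ∩ {z : |z| < R} is the union of two rectifiable Jordan arcs having 0 as a common endpoint, each of which is quasismooth: there is M ≥ 1 such that for any two points z₁, z₂ on the arc, the length of the subarc between z₁ and z₂ is at most M |z₁ − z₂|. Then there exist constants C, c > 0 such that |φ̂(t) − φ̂(0)| ≤ C exp(−c/|t|^{p−1}) for all t ∈ cl(G). -/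
open MeasureTheory Filter Set

/-- A Jordan domain: a bounded simply connected open subset of `ℂ` whose
boundary is a Jordan curve (the image of an injective continuous map of the
unit circle). -/
def IsJordanDomain (G : Set ℂ) : Prop :=
  IsOpen G ∧ Bornology.IsBounded G ∧ SimplyConnectedSpace G ∧
    ∃ γ : C(Metric.sphere (0 : ℂ) 1, ℂ),
      Function.Injective γ ∧ Set.range γ = frontier G

/-- `Γ` is a rectifiable quasismooth Jordan arc with an endpoint at `0`:
there is an injective continuous parametrization `γ` of `Γ` on `[0,1]` with
`γ 0 = 0`, and a constant `M ≥ 1` such that the length (total variation) of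
every subarc is at most `M` times the distance between its endpoints. -/
def IsQuasismoothArcFromZero (Γ : Set ℂ) : Prop :=
  ∃ γ : ℝ → ℂ, ContinuousOn γ (Set.Icc 0 1) ∧ Set.InjOn γ (Set.Icc 0 1) ∧
    γ '' Set.Icc 0 1 = Γ ∧ γ 0 = 0 ∧
    ∃ M : ℝ, 1 ≤ M ∧ ∀ a ∈ Set.Icc (0 : ℝ) 1, ∀ b ∈ Set.Icc (0 : ℝ) 1, a ≤ b →
      eVariationOn γ (Set.Icc a b) ≤ ENNReal.ofReal (M * ‖γ b - γ a‖)

open scoped Topology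

/-- Two continuous functions with the same exponential on a preconnected set differ by a
constant there. -/
lemma IsPreconnected.exists_sub_eq_of_exp_eq {X : Type*} [TopologicalSpace X] {s : Set X}
    (hs : IsPreconnected s) {g₁ g₂ : X → ℂ} (h₁ : ContinuousOn g₁ s) (h₂ : ContinuousOn g₂ s)
    (he : ∀ x ∈ s, Complex.exp (g₁ x) = Complex.exp (g₂ x)) :
    ∃ c : ℂ, Complex.exp c = 1 ∧ ∀ x ∈ s, g₁ x = g₂ x + c := by
  rcases s.eq_empty_or_nonempty with rfl | ⟨a, ha⟩
  · exact ⟨0, by simp, by simp⟩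
  have hd : ∀ x ∈ s, Complex.exp (g₁ x - g₂ x) = 1 := fun x hx ↦ by
    rw [Complex.exp_sub, he x hx, div_self (Complex.exp_ne_zero _)]
  refine ⟨g₁ a - g₂ a, hd a ha, fun x hx ↦ ?_⟩
  have key := Complex.isCoveringMap_exp.isSeparatedMap.constOn_of_comp
    Complex.isCoveringMap_exp.isLocalHomeomorph.isLocallyInjective hs (h₁.sub h₂)
    (fun y hy z hz ↦ Subtype.ext ((hd y hy).trans (hd z hz).symm)) hx ha
  simp only [Pi.sub_apply] at key
  rw [← key]; ring

/-- The identity has no continuous logarithm on a circle. -/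
lemma not_forall_exp_circle_eq {L : ℂ → ℂ} (hL : Continuous L) {c : ℂ} {N : ℝ} (hN : N ≠ 0) :
    ¬ ∀ θ : ℝ, Complex.exp (L (circleMap c N θ)) = circleMap c N θ - c := by
  intro h
  have hc : Continuous fun θ : ℝ ↦ (θ : ℂ) * Complex.I := by fun_prop
  obtain ⟨k, -, hk⟩ := isPreconnected_univ.exists_sub_eq_of_exp_eq
    (g₁ := fun θ : ℝ ↦ L (circleMap c N θ))
    (g₂ := fun θ : ℝ ↦ (θ : ℂ) * Complex.I + Complex.log N)
    (hL.comp (continuous_circleMap c N)).continuousOn (by fun_prop)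
    (fun θ _ ↦ by
      rw [h, Complex.exp_add, Complex.exp_log (by exact_mod_cast hN), circleMap]; ring)
  have h0 := hk 0 (mem_univ _)
  have h1 := hk (2 * Real.pi) (mem_univ _)
  have : circleMap c N (2 * Real.pi) = circleMap c N 0 := by
    simpa using periodic_circleMap c N 0
  simp only [this] at h1
  rw [h1] at h0
  have : (Real.pi : ℂ) * Complex.I = 0 := by
    push_cast at h0
    linear_combination h0 / 2
  simp [Real.pi_ne_zero] at this

/-- If `(z - a) / (z - b)` has a continuous logarithm on the boundary of a bounded set
`U` containing `a`, then `b` belongs to the closure of `U`. -/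
lemma mem_closure_of_log_on_frontier {U : Set ℂ} (hb : Bornology.IsBounded U)
    {a b : ℂ} (ha : a ∈ U) {g : ℂ → ℂ} (hg : ContinuousOn g (frontier U))
    (he : ∀ z ∈ frontier U, Complex.exp (g z) = (z - a) / (z - b)) : b ∈ closure U := by
  classical
  by_contra hbU
  obtain ⟨G, hG⟩ := ContinuousMap.exists_extension (isClosed_frontier.isClosedEmbedding_subtypeVal
    (X := ℂ) (s := frontier U))
    ⟨(frontier U).domRestrict g, continuousOn_iff_continuous_domRestrict.1 hg⟩
  have hG' : ∀ z ∈ frontier U, G z = g z := fun z hz ↦ by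
    simpa using DFunLike.congr_fun hG ⟨z, hz⟩
  set q : ℂ → ℂ := fun z ↦ if z ∈ U then (z - b) * Complex.exp (G z) else z - a with hq
  have hbne : ∀ z ∈ closure U, z - b ≠ 0 := fun z hz h ↦ hbU (sub_eq_zero.1 h ▸ hz)
  have hqc : Continuous q := by
    refine Continuous.if (fun z hz ↦ ?_) (by fun_prop) (by fun_prop)
    rw [hG' z hz, he z hz, mul_div_cancel₀ _ (hbne z (frontier_subset_closure hz))]
  have hq0 : ∀ z, q z ≠ 0 := by
    intro z
    by_cases hz : z ∈ U
    · simp [hq, hz, hbne z (subset_closure hz)]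
    · simp only [hq, hz, if_false]
      intro h
      exact hz (sub_eq_zero.1 h ▸ ha)
  have hsc : IsSimplyConnected (univ : Set ℂ) := by
    have := (convex_univ (𝕜 := ℝ) (E := ℂ)).contractibleSpace univ_nonempty
    exact SimplyConnectedSpace.ofContractible _
  obtain ⟨L, hL, hLe⟩ := Complex.exists_continuousOn_eqOn_exp_comp hsc isOpen_univ
    hqc.continuousOn (by simpa using hq0)
  obtain ⟨N, hN, hUN⟩ := hb.subset_ball_lt 0 a
  refine not_forall_exp_circle_eq (continuousOn_univ.1 hL) hN.ne' (c := a) fun θ ↦ ?_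
  have hm : circleMap a N θ ∉ U := fun h ↦ by
    have := hUN h
    simp [circleMap, abs_of_pos hN] at this
  simpa [hq, hm] using hLe (mem_univ (circleMap a N θ))

/-- Gluing of continuous logarithms over two closed sets with preconnected intersection. -/
lemma exists_log_union {X : Type*} [TopologicalSpace X] {F₁ F₂ : Set X}
    (hF₁ : IsClosed F₁) (hF₂ : IsClosed F₂)
    (hc : IsPreconnected (F₁ ∩ F₂)) {h g₁ g₂ : X → ℂ} (h₁ : ContinuousOn g₁ F₁)
    (h₂ : ContinuousOn g₂ F₂) (he₁ : ∀ z ∈ F₁, Complex.exp (g₁ z) = h z)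
    (he₂ : ∀ z ∈ F₂, Complex.exp (g₂ z) = h z) :
    ∃ g : X → ℂ, ContinuousOn g (F₁ ∪ F₂) ∧ ∀ z ∈ F₁ ∪ F₂, Complex.exp (g z) = h z := by
  classical
  obtain ⟨c, hc1, hcs⟩ := hc.exists_sub_eq_of_exp_eq (h₁.mono inter_subset_left)
    (h₂.mono inter_subset_right) (fun z hz ↦ (he₁ z hz.1).trans (he₂ z hz.2).symm)
  set g : X → ℂ := fun z ↦ if z ∈ F₁ then g₁ z else g₂ z + c with hg
  have hg1 : EqOn g g₁ F₁ := fun z hz ↦ by simp [hg, hz]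
  have hg2 : EqOn g (fun z ↦ g₂ z + c) F₂ := fun z hz ↦ by
    by_cases hz1 : z ∈ F₁
    · simp [hg, hz1, hcs z ⟨hz1, hz⟩]
    · simp [hg, hz1]
  refine ⟨g, (h₁.congr hg1).union_of_isClosed ((h₂.add continuousOn_const).congr hg2) hF₁ hF₂, ?_⟩
  rintro z (hz | hz)
  · rw [hg1 hz, he₁ z hz]
  · rw [hg2 hz, Complex.exp_add, hc1, mul_one, he₂ z hz]

/-- If the segment from `a` to `b` misses `z`, then `(z - a) / (z - b)` lies in the slit plane. -/
lemma div_mem_slitPlane_of_notMem_segment {a b z : ℂ} (h : z ∉ segment ℝ a b) :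
    (z - a) / (z - b) ∈ Complex.slitPlane := by
  by_contra hs
  apply h
  have hb : z - b ≠ 0 := fun hb ↦ h (by rw [sub_eq_zero.1 hb]; exact right_mem_segment ℝ a b)
  obtain ⟨x, hx0, hx⟩ : ∃ x : ℝ, 0 ≤ x ∧ (z - a) / (z - b) = -(x : ℂ) := by
    refine ⟨-((z - a) / (z - b)).re, ?_, ?_⟩
    · rw [Complex.mem_slitPlane_iff, not_or, not_lt] at hs
      linarith [hs.1]
    · rw [Complex.mem_slitPlane_iff, not_or, not_not] at hs
      apply Complex.ext <;> simp [hs.2]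
  rw [div_eq_iff hb] at hx
  refine ⟨1 / (1 + x), x / (1 + x), by positivity, by positivity, by field_simp, ?_⟩
  have : (1 + x : ℂ) ≠ 0 := by
    exact_mod_cast (by positivity : (1 + x : ℝ) ≠ 0)
  simp only [Complex.real_smul]
  push_cast
  field_simp
  linear_combination -hx

lemma exists_log_of_segment {F : Set ℂ} {a b : ℂ} (h : Disjoint (segment ℝ a b) F) :
    ∃ g : ℂ → ℂ, ContinuousOn g F ∧ ∀ z ∈ F, Complex.exp (g z) = (z - a) / (z - b) := by
  have hs : ∀ z ∈ F, (z - a) / (z - b) ∈ Complex.slitPlane := fun z hz ↦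
    div_mem_slitPlane_of_notMem_segment (disjoint_right.1 h hz)
  have hb : ∀ z ∈ F, z - b ≠ 0 := fun z hz h0 ↦
    disjoint_right.1 h hz (by rw [sub_eq_zero.1 h0]; exact right_mem_segment ℝ a b)
  exact ⟨fun z ↦ Complex.log ((z - a) / (z - b)),
    ContinuousOn.clog (by fun_prop (disch := assumption)) hs,
    fun z hz ↦ Complex.exp_log (Complex.slitPlane_ne_zero (hs z hz))⟩

/-- Two points of a preconnected open set are not separated by any set disjoint from it, in the
sense that `(z - a) / (z - b)` has a continuous logarithm there. -/
lemma exists_log_of_isPreconnected {G F : Set ℂ} (hGo : IsOpen G) (hG : IsPreconnected G)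
    (hd : Disjoint G F) {a b : ℂ} (ha : a ∈ G) (hb : b ∈ G) :
    ∃ g : ℂ → ℂ, ContinuousOn g F ∧ ∀ z ∈ F, Complex.exp (g z) = (z - a) / (z - b) := by
  have hne : ∀ x ∈ G, ∀ z ∈ F, z - x ≠ 0 := fun x hx z hz h ↦
    disjoint_left.1 hd hx (sub_eq_zero.1 h ▸ hz)
  refine hG.induction₂' (fun x y ↦ ∃ g : ℂ → ℂ, ContinuousOn g F ∧
    ∀ z ∈ F, Complex.exp (g z) = (z - x) / (z - y)) (fun x hx ↦ ?_) ?_ ha hb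
  · obtain ⟨ε, hε, hεG⟩ := Metric.isOpen_iff.1 hGo x hx
    filter_upwards [mem_nhdsWithin_of_mem_nhds (Metric.ball_mem_nhds x hε)] with y hy
    have hsub : segment ℝ x y ⊆ G :=
      ((convex_ball x ε).segment_subset (Metric.mem_ball_self hε) hy).trans hεG
    exact ⟨exists_log_of_segment (hd.mono_left hsub),
      exists_log_of_segment (hd.mono_left (by rwa [segment_symm]))⟩
  · rintro x y w hx hy hw ⟨g₁, h₁, he₁⟩ ⟨g₂, h₂, he₂⟩
    refine ⟨fun z ↦ g₁ z + g₂ z, h₁.add h₂, fun z hz ↦ ?_⟩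
    rw [Complex.exp_add, he₁ z hz, he₂ z hz]
    have := hne y hy z hz
    have := hne w hw z hz
    field_simp

/-- A form of Janiszewski's theorem: if a connected part `P` of the boundary of `G` contains
`∂G ∩ ∂B(0, ρ)` and misses a ball `B(0, r)`, then a subset of `B(0, ρ)` with no
boundary in `G ∩ B(0, ρ)` is either disjoint from `B(0, r)` or contains `G ∩ B(0, r)` in its
closure. -/
lemma mem_closure_of_frontier_subset {G U P : Set ℂ} {r ρ : ℝ} (hrρ : r ≤ ρ) (hGo : IsOpen G)
    (hG : IsPreconnected G) (hUρ : U ⊆ Metric.ball 0 ρ)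
    (hU : frontier U ⊆ frontier G ∪ Metric.sphere 0 ρ) (hPc : IsClosed P) (hP : IsPreconnected P)
    (hPG : P ⊆ frontier G) (hPr : Disjoint (Metric.ball 0 r) P)
    (hPρ : frontier G ∩ Metric.sphere 0 ρ ⊆ P) {a b : ℂ} (ha : a ∈ U) (haG : a ∈ G)
    (har : a ∈ Metric.ball 0 r) (hbG : b ∈ G) (hbr : b ∈ Metric.ball 0 r) : b ∈ closure U := by
  have hseg : segment ℝ a b ⊆ Metric.ball 0 r := (convex_ball 0 r).segment_subset har hbr
  obtain ⟨g₁, h₁, he₁⟩ := exists_log_of_segment (F := P ∪ Metric.sphere 0 ρ) (a := a) (b := b)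
    (disjoint_union_right.2 ⟨hPr.mono_left hseg,
      ((Metric.sphere_disjoint_ball.mono_right (Metric.ball_subset_ball hrρ)).mono_right
        hseg).symm⟩)
  obtain ⟨g₂, h₂, he₂⟩ := exists_log_of_isPreconnected hGo hG
    (disjoint_iff_inter_eq_empty.2 hGo.inter_frontier_eq) haG hbG
  have hint : (P ∪ Metric.sphere 0 ρ) ∩ frontier G = P := by
    rw [union_inter_distrib_right, inter_eq_left.2 hPG, inter_comm (Metric.sphere _ _),
      union_eq_left.2 hPρ]
  obtain ⟨g, hg, he⟩ := exists_log_union (hPc.union Metric.isClosed_sphere) isClosed_frontier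
    (by rwa [hint]) h₁ h₂ he₁ he₂
  have hsub : frontier U ⊆ (P ∪ Metric.sphere 0 ρ) ∪ frontier G := hU.trans (by grind)
  exact mem_closure_of_log_on_frontier (Metric.isBounded_ball.subset hUρ) ha (hg.mono hsub)
    fun z hz ↦ he z (hsub hz)

/-- The inverse of an injective holomorphic function on an open set is holomorphic on every open
set contained in the range. -/
lemma differentiableOn_leftInverse {f g : ℂ → ℂ} {G D : Set ℂ} (hG : IsOpen G) (hD : IsOpen D)
    (hf : DifferentiableOn ℂ f G) (hinj : InjOn f G) (hg : MapsTo g D G)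
    (hfg : ∀ w ∈ D, f (g w) = w) : DifferentiableOn ℂ g D := by
  have hfa : AnalyticOnNhd ℂ f G := hf.analyticOnNhd hG
  have hgf : ∀ z ∈ G, f z ∈ D → g (f z) = z := fun z hz hw ↦ hinj (hg hw) hz (hfg _ hw)
  have hnc : ∀ z ∈ G, ¬ ∀ᶠ x in 𝓝 z, f x = f z := by
    intro z hz h
    have h2 : ∀ᶠ x in 𝓝 z, x = z := by
      filter_upwards [h, hG.mem_nhds hz] with x hx hxG using hinj hxG hz hx
    have := (h2.filter_mono nhdsWithin_le_nhds).and (self_mem_nhdsWithin (s := ({z}ᶜ : Set ℂ)))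
    obtain ⟨x, hx, hx'⟩ := this.exists
    exact hx' hx
  have hgc : ∀ w ∈ D, ContinuousAt g w := by
    intro w hw
    have hz := hg hw
    have hopen := ((hfa _ hz).eventually_constant_or_nhds_le_map_nhds).resolve_left (hnc _ hz)
    rw [hfg w hw] at hopen
    intro s hs
    rw [Filter.mem_map]
    have hs' : f '' (s ∩ G) ∈ 𝓝 w :=
      hopen (image_mem_map (Filter.inter_mem hs (hG.mem_nhds hz)))
    filter_upwards [hs', hD.mem_nhds hw] with y hy hyD
    obtain ⟨x, ⟨hxs, hxG⟩, rfl⟩ := hy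
    rwa [mem_preimage, hgf x hxG hyD]
  intro w hw
  refine AnalyticAt.differentiableWithinAt
    (Complex.analyticAt_of_differentiable_on_punctured_nhds_of_continuousAt ?_ (hgc w hw))
  have hz := hg hw
  have hd : ∀ᶠ x in 𝓝[≠] (g w), deriv f x ≠ 0 := by
    refine ((hfa _ hz).deriv.eventually_eq_zero_or_eventually_ne_zero).resolve_left fun h ↦ ?_
    obtain ⟨ε, hε, hb⟩ := Metric.eventually_nhds_iff_ball.1 (h.and (hG.mem_nhds hz))
    refine hnc _ hz ?_
    filter_upwards [Metric.ball_mem_nhds _ hε] with x hx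
    exact Metric.isOpen_ball.is_const_of_deriv_eq_zero (convex_ball _ _).isPreconnected
      (hf.mono fun y hy ↦ (hb y hy).2) (fun y hy ↦ (hb y hy).1) hx (Metric.mem_ball_self hε)
  have hne : Tendsto g (𝓝[≠] w) (𝓝[≠] (g w)) := by
    refine tendsto_nhdsWithin_iff.2 ⟨(hgc w hw).tendsto.mono_left nhdsWithin_le_nhds, ?_⟩
    filter_upwards [self_mem_nhdsWithin, mem_nhdsWithin_of_mem_nhds (hD.mem_nhds hw)] with y hy hyD
    intro h
    exact hy (by rw [mem_singleton_iff, ← hfg y hyD, h, hfg w hw])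
  filter_upwards [hne.eventually hd, mem_nhdsWithin_of_mem_nhds (hD.mem_nhds hw)] with y hy hyD
  exact (HasDerivAt.of_local_left_inverse (hgc y hyD)
    (hf.differentiableAt (hG.mem_nhds (hg hyD))).hasDerivAt hy
    (by filter_upwards [hD.mem_nhds hyD] with x hx using hfg x hx)).differentiableAt

/-- Harnack-type growth bound for holomorphic functions with positive real part. -/
lemma norm_le_of_re_pos {F : ℂ → ℂ} {R : ℝ} (hR : 0 < R)
    (hF : DifferentiableOn ℂ F (Metric.ball 0 R)) (hpos : ∀ w ∈ Metric.ball 0 R, 0 < (F w).re)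
    {w : ℂ} (hw : w ∈ Metric.ball 0 R) : ‖F w‖ * (R - ‖w‖) ≤ 4 * R * ‖F 0‖ := by
  have h0 : 0 < ‖F 0‖ := norm_pos_iff.2 fun h ↦ by
    simpa [h] using hpos 0 (Metric.mem_ball_self hR)
  have hwR : 0 < R - ‖w‖ := sub_pos.2 (mem_ball_zero_iff.1 hw)
  have h := Complex.borelCaratheodory (f := fun z ↦ -F z) h0 hF.neg
    (fun z hz ↦ by
      have := hpos z hz
      simp only [mem_ofPred_eq, Complex.neg_re]
      linarith) hR hw
  rw [norm_neg, norm_neg, ← add_div, le_div_iff₀ hwR] at h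
  nlinarith [norm_nonneg w]

open scoped Topology ENNReal in
/-- Area bound for the derivative of an injective holomorphic map. -/
lemma lintegral_norm_deriv_sq_le {K : ℂ → ℂ} {S T : Set ℂ} (hS : IsOpen S)
    (hK : DifferentiableOn ℂ K S) (hinj : InjOn K S) (hmaps : MapsTo K S T) :
    ∫⁻ ξ in S, ENNReal.ofReal (‖deriv K ξ‖ ^ 2) ≤ volume T := by
  have hdet : ∀ c : ℂ, |(ContinuousLinearMap.det (c • (1 : ℂ →L[ℝ] ℂ)))| = ‖c‖ ^ 2 := by
    intro c
    have : ((c • (1 : ℂ →L[ℝ] ℂ) : ℂ →L[ℝ] ℂ) : ℂ →ₗ[ℝ] ℂ) = Algebra.lmul ℝ ℂ c := by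
      ext; simp
    rw [ContinuousLinearMap.det, this, ← Algebra.norm_apply,
      Algebra.norm_complex_eq]
    simp [Complex.normSq_eq_norm_sq]
  have h := lintegral_abs_det_fderiv_le_addHaar_image volume hS.measurableSet
    (fun ξ hξ ↦ (hK.differentiableAt
      (hS.mem_nhds hξ)).hasDerivAt.complexToReal_fderiv.hasFDerivWithinAt) hinj
  simp only [hdet] at h
  exact h.trans (measure_mono hmaps.image_subset)

open scoped Topology ENNReal in
/-- One-dimensional step of the length-area method: a holomorphic function with
oscillation at least `1 / 4` on a vertical segment of length at most `π / 2` has energy bounded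
below there. -/
lemma energy_lower_bound {K : ℂ → ℂ} {S : Set ℂ} (hS : IsOpen S) (hK : DifferentiableOn ℂ K S)
    {s θ : ℝ} (hθ : |θ| ≤ Real.pi / 2) (hseg : ∀ τ ∈ uIcc 0 θ, (s + τ * Complex.I : ℂ) ∈ S)
    (hosc : 1 / 4 ≤ ‖K (s + θ * Complex.I) - K s‖) :
    ENNReal.ofReal (1 / (16 * Real.pi)) ≤
      ∫⁻ τ : ℝ, S.indicator (fun ξ ↦ ENNReal.ofReal (‖deriv K ξ‖ ^ 2)) (s + τ * Complex.I) := by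
  have hπ := Real.pi_pos
  have hl : Continuous fun τ : ℝ ↦ (s + τ * Complex.I : ℂ) := by fun_prop
  have hdc : ContinuousOn (fun τ : ℝ ↦ deriv K (s + τ * Complex.I)) (uIcc 0 θ) :=
    (hK.deriv hS).continuousOn.comp hl.continuousOn hseg
  have hder : ∀ τ ∈ uIcc 0 θ, HasDerivAt (fun τ : ℝ ↦ K (s + τ * Complex.I))
      (deriv K (s + τ * Complex.I) * Complex.I) τ := by
    intro τ hτ
    have h1 := (hK.differentiableAt (hS.mem_nhds (hseg τ hτ))).hasDerivAt
    have h2 : HasDerivAt (fun τ : ℝ ↦ (s + τ * Complex.I : ℂ)) Complex.I τ := by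
      simpa using ((Complex.ofRealCLM.hasDerivAt (x := τ)).mul_const Complex.I).const_add (s : ℂ)
    exact h1.comp τ h2
  have hftc := intervalIntegral.integral_eq_sub_of_hasDerivAt hder
    (hdc.mul continuousOn_const).intervalIntegrable
  have hint2 : IntegrableOn (fun τ : ℝ ↦ ‖deriv K (s + τ * Complex.I)‖ ^ 2) (uIoc 0 θ) :=
    ((hdc.norm.pow 2).integrableOn_compact isCompact_uIcc).mono_set uIoc_subset_uIcc
  have hint1 : IntegrableOn (fun τ : ℝ ↦ ‖deriv K (s + τ * Complex.I)‖) (uIoc 0 θ) :=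
    (hdc.norm.integrableOn_compact isCompact_uIcc).mono_set uIoc_subset_uIcc
  have hle1 : (1 : ℝ) / 4 ≤ ∫ τ in uIoc 0 θ, ‖deriv K (s + τ * Complex.I)‖ := by
    have := intervalIntegral.norm_integral_le_integral_norm_uIoc (a := 0) (b := θ) (μ := volume)
      (f := fun τ : ℝ ↦ deriv K (s + τ * Complex.I) * Complex.I)
    rw [hftc] at this
    simp only [norm_mul, Complex.norm_I, mul_one, Complex.ofReal_zero, zero_mul, add_zero] at this
    exact hosc.trans this
  have hvol : volume.real (uIoc 0 θ) = |θ| := by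
    simp [Measure.real, Real.volume_uIoc]
  have hle2 : ∫ τ in uIoc 0 θ, ‖deriv K (s + τ * Complex.I)‖ ≤
      ∫ τ in uIoc 0 θ, (2 * Real.pi * ‖deriv K (s + τ * Complex.I)‖ ^ 2 + 1 / (8 * Real.pi)) := by
    refine integral_mono hint1 ((hint2.const_mul _).add
      (integrableOn_const (by simp [Real.volume_uIoc]))) fun τ ↦ ?_
    have h := sq_nonneg (4 * Real.pi * ‖deriv K (s + τ * Complex.I)‖ - 1)
    have : 0 ≤ (4 * Real.pi * ‖deriv K (s + τ * Complex.I)‖ - 1) ^ 2 / (8 * Real.pi) := by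
      positivity
    have e : (4 * Real.pi * ‖deriv K (s + τ * Complex.I)‖ - 1) ^ 2 / (8 * Real.pi) =
      2 * Real.pi * ‖deriv K (s + τ * Complex.I)‖ ^ 2 + 1 / (8 * Real.pi)
        - ‖deriv K (s + τ * Complex.I)‖ := by
      field_simp; ring
    simp only
    linarith
  rw [integral_add (hint2.const_mul _) (integrableOn_const (by simp [Real.volume_uIoc])),
    integral_const_mul, setIntegral_const, hvol, smul_eq_mul] at hle2
  have hle3 : |θ| * (1 / (8 * Real.pi)) ≤ 1 / 16 := by
    rw [mul_one_div, div_le_iff₀ (by positivity)]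
    linarith
  have hle4 : 1 / (16 * Real.pi) ≤ ∫ τ in uIoc 0 θ, ‖deriv K (s + τ * Complex.I)‖ ^ 2 := by
    rw [div_le_iff₀ (by positivity)]
    nlinarith
  calc ENNReal.ofReal (1 / (16 * Real.pi))
      ≤ ENNReal.ofReal (∫ τ in uIoc 0 θ, ‖deriv K (s + τ * Complex.I)‖ ^ 2) :=
        ENNReal.ofReal_le_ofReal hle4
    _ = ∫⁻ τ in uIoc 0 θ, ENNReal.ofReal (‖deriv K (s + τ * Complex.I)‖ ^ 2) :=
        ofReal_integral_eq_lintegral_ofReal hint2 (ae_of_all _ fun _ ↦ by positivity)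
    _ = ∫⁻ τ in uIoc 0 θ, S.indicator (fun ξ ↦ ENNReal.ofReal (‖deriv K ξ‖ ^ 2))
          (s + τ * Complex.I) := by
        refine setLIntegral_congr_fun measurableSet_uIoc fun τ hτ ↦ ?_
        rw [indicator_of_mem (hseg τ (uIoc_subset_uIcc hτ))]
    _ ≤ _ := setLIntegral_le_lintegral _ _

open scoped Topology ENNReal in
/-- The length-area estimate in logarithmic coordinates. -/
lemma sub_le_of_oscillation {K : ℂ → ℂ} {S : Set ℂ} (hS : IsOpen S) (hK : DifferentiableOn ℂ K S)
    (hinj : InjOn K S) (hmaps : MapsTo K S (Metric.closedBall 0 1)) {s₁ s₂ : ℝ}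
    (hosc : ∀ s ∈ Ioo s₁ s₂, ∃ θ : ℝ, |θ| ≤ Real.pi / 2 ∧
      (∀ τ ∈ uIcc 0 θ, (s + τ * Complex.I : ℂ) ∈ S) ∧
      1 / 4 ≤ ‖K (s + θ * Complex.I) - K s‖) : s₂ - s₁ ≤ 16 * Real.pi ^ 2 := by
  have hπ := Real.pi_pos
  set E : ℂ → ℝ≥0∞ := S.indicator fun ξ ↦ ENNReal.ofReal (‖deriv K ξ‖ ^ 2) with hE
  have hEm : Measurable E :=
    (((measurable_deriv K).norm.pow_const 2).ennreal_ofReal).indicator hS.measurableSet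
  have harea : ∫⁻ ξ, E ξ ≤ ENNReal.ofReal Real.pi := by
    rw [hE, lintegral_indicator hS.measurableSet]
    refine (lintegral_norm_deriv_sq_le hS hK hinj hmaps).trans (le_of_eq ?_)
    rw [Complex.volume_closedBall]
    simp [ENNReal.ofReal, Real.toNNReal_of_nonneg hπ.le]
    rfl
  have hprod : ∫⁻ s : ℝ, ∫⁻ τ : ℝ, E (s + τ * Complex.I) = ∫⁻ ξ, E ξ := by
    rw [← Complex.volume_preserving_equiv_real_prod.symm.lintegral_comp_emb
      Complex.measurableEquivRealProd.symm.measurableEmbedding, Measure.volume_eq_prod,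
      lintegral_prod (fun z ↦ E (Complex.measurableEquivRealProd.symm z))
        (hEm.comp Complex.measurableEquivRealProd.symm.measurable).aemeasurable]
    simp only [Complex.measurableEquivRealProd_symm_apply, Complex.mk_eq_add_mul_I]
  have hlow : ENNReal.ofReal (1 / (16 * Real.pi)) * volume (Ioo s₁ s₂) ≤
      ENNReal.ofReal Real.pi := by
    rw [← setLIntegral_const]
    refine le_trans ?_ ((setLIntegral_le_lintegral (Ioo s₁ s₂) _).trans (hprod.trans_le harea))
    refine setLIntegral_mono' measurableSet_Ioo fun s hs ↦ ?_
    obtain ⟨θ, h1, h2, h3⟩ := hosc s hs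
    exact energy_lower_bound hS hK h1 h2 h3
  rw [Real.volume_Ioo, ← ENNReal.ofReal_mul (by positivity),
    ENNReal.ofReal_le_ofReal_iff hπ.le, one_div, inv_mul_le_iff₀ (by positivity)] at hlow
  linarith

/-- Length-area estimate on circular crosscuts of a disc centred at a boundary point: if a
bounded injective holomorphic function oscillates by at least `1 / 4` on each crosscut of radius
between `η` and `δ`, then `δ` is at most a constant multiple of `η`. -/
lemma le_exp_mul_of_oscillation {k : ℂ → ℂ} {R η δ : ℝ} (hη : 0 < η)
    (hR : 0 < R) {ζ : ℂ} (hζ : ‖ζ‖ = R) (hk : DifferentiableOn ℂ k (Metric.ball 0 R))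
    (hinj : InjOn k (Metric.ball 0 R))
    (hmaps : MapsTo k (Metric.ball 0 R) (Metric.closedBall 0 1))
    (hosc : ∀ x ∈ Ioo η δ, ∃ v ∈ Metric.ball (0 : ℂ) R, ‖v - ζ‖ = x ∧
      1 / 4 ≤ ‖k v - k (ζ * (1 - (x / R : ℝ)))‖) :
    δ ≤ Real.exp (16 * Real.pi ^ 2) * η := by
  have hπ := Real.pi_pos
  rcases le_or_gt δ η with hle | hlt
  · exact hle.trans (le_mul_of_one_le_left hη.le (Real.one_le_exp (by positivity)))
  have hδ : 0 < δ := hη.trans hlt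
  have hζ0 : ζ ≠ 0 := norm_pos_iff.1 (hζ ▸ hR)
  set m : ℂ → ℂ := fun ξ ↦ ζ * (1 - Complex.exp ξ) with hm
  have hmd : Differentiable ℂ m := by fun_prop
  set S : Set ℂ := {ξ | |ξ.im| < Real.pi} ∩ m ⁻¹' Metric.ball 0 R with hSdef
  have hS : IsOpen S := (isOpen_lt (by fun_prop) continuous_const).inter
    (Metric.isOpen_ball.preimage hmd.continuous)
  have hmS : MapsTo m S (Metric.ball 0 R) := fun ξ hξ ↦ hξ.2
  have hminj : InjOn m S := by
    intro x hx y hy hxy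
    have h1 : Complex.exp x = Complex.exp y := by
      have := mul_left_cancel₀ hζ0 hxy
      linear_combination -this
    have hx1 := abs_lt.1 (show |x.im| < Real.pi from hx.1)
    have hy1 := abs_lt.1 (show |y.im| < Real.pi from hy.1)
    exact Complex.exp_inj_of_neg_pi_lt_of_le_pi hx1.1 hx1.2.le hy1.1 hy1.2.le h1
  have hS_iff : ∀ s τ : ℝ, m (s + τ * Complex.I) ∈ Metric.ball 0 R ↔
      Real.exp s < 2 * Real.cos τ := by
    intro s τ
    have hpos := Real.exp_pos s
    rw [mem_ball_zero_iff, hm]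
    simp only
    rw [norm_mul, hζ, mul_lt_iff_lt_one_right hR, ← sq_lt_one_iff₀ (norm_nonneg _),
      ← Complex.normSq_eq_norm_sq, Complex.normSq_apply]
    simp only [Complex.sub_re, Complex.one_re, Complex.exp_re, Complex.add_re, Complex.ofReal_re,
      Complex.mul_re, Complex.I_re, mul_zero, Complex.ofReal_im, Complex.I_im, mul_one, sub_self,
      add_zero, Complex.add_im, Complex.mul_im, zero_add, Complex.sub_im, Complex.one_im,
      Complex.exp_im]
    have e : (1 - Real.exp s * Real.cos τ) * (1 - Real.exp s * Real.cos τ) +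
      (0 - Real.exp s * Real.sin τ) * (0 - Real.exp s * Real.sin τ) =
        1 + Real.exp s * (Real.exp s - 2 * Real.cos τ) := by
      linear_combination (Real.exp s) ^ 2 * Real.sin_sq_add_cos_sq τ
    rw [e]
    constructor
    · intro h
      by_contra! h'
      nlinarith
    · intro h
      nlinarith
  have key := sub_le_of_oscillation hS (hk.comp hmd.differentiableOn hmS)
    (hinj.comp hminj hmS) (hmaps.comp hmS) (s₁ := Real.log (η / R)) (s₂ := Real.log (δ / R)) ?_
  · rw [← Real.log_div (by positivity) (by positivity), div_div_div_cancel_right₀ hR.ne',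
      Real.log_le_iff_le_exp (by positivity), div_le_iff₀ hη] at key
    exact key
  · intro s hs
    have hs1 := (Real.log_lt_iff_lt_exp (by positivity)).1 hs.1
    have hs2 := (Real.lt_log_iff_exp_lt (by positivity)).1 hs.2
    rw [div_lt_iff₀ hR] at hs1
    rw [lt_div_iff₀ hR] at hs2
    obtain ⟨v, hv, hvx, hvk⟩ := hosc (Real.exp s * R) ⟨hs1, hs2⟩
    set u : ℂ := 1 - v / ζ with hu
    have hun : ‖u‖ = Real.exp s := by
      have : u = -(v - ζ) / ζ := by rw [hu]; field_simp; ring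
      rw [this, norm_div, norm_neg, hvx, hζ]
      field_simp
    have hu0 : u ≠ 0 := norm_pos_iff.1 (hun ▸ Real.exp_pos s)
    have hexp : Complex.exp (s + u.arg * Complex.I) = u := by
      conv_rhs => rw [← Complex.exp_log hu0, Complex.log, hun, Real.log_exp]
    have hmv : m (s + u.arg * Complex.I) = v := by
      simp only [hm, hexp]
      rw [hu]
      field_simp
      ring
    have hcos : Real.exp s < 2 * Real.cos u.arg := by
      rw [← hS_iff, hmv]; exact hv
    have hcpos : 0 < Real.cos u.arg := by linarith [Real.exp_pos s]
    have harg : |u.arg| < Real.pi / 2 := by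
      by_contra! h
      have := Real.cos_nonpos_of_pi_div_two_le_of_le h
        (by linarith [Complex.abs_arg_le_pi u])
      rw [Real.cos_abs] at this
      linarith
    refine ⟨u.arg, harg.le, fun τ hτ ↦ ⟨?_, ?_⟩, ?_⟩
    · have h1 : |τ| ≤ |u.arg| := by
        simpa using abs_sub_left_of_mem_uIcc hτ
      simp only [mem_ofPred_eq, Complex.add_im, Complex.ofReal_im, Complex.mul_im,
        Complex.ofReal_re, Complex.I_im, mul_one, Complex.I_re, mul_zero, add_zero, zero_add]
      linarith
    · have h1 : |τ| ≤ |u.arg| := by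
        simpa using abs_sub_left_of_mem_uIcc hτ
      rw [mem_preimage, hS_iff]
      have : Real.cos |u.arg| ≤ Real.cos |τ| :=
        Real.cos_le_cos_of_nonneg_of_le_pi (abs_nonneg _) (Complex.abs_arg_le_pi u) h1
      rw [Real.cos_abs, Real.cos_abs] at this
      linarith
    · simp only [Function.comp_apply, hmv]
      simpa [hm, hR.ne'] using hvk

/-- In a cusp of order `p` the argument is controlled by `‖z‖ ^ (p - 1)`. -/
lemma abs_arg_le_of_mem_cusp {c p : ℝ} (hc : 0 < c) (hp : 1 < p) {z : ℂ} (hre : 0 < z.re)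
    (him : |z.im| < c * z.re ^ p) : |z.arg| ≤ Real.pi / 2 * c * ‖z‖ ^ (p - 1) := by
  have hπ := Real.pi_pos
  have hz : 0 < ‖z‖ := norm_pos_iff.2 fun h ↦ by simp [h] at hre
  have harg : |z.arg| ≤ Real.pi / 2 := (Complex.abs_arg_lt_pi_div_two_iff.2 (Or.inl hre)).le
  have h1 := Real.mul_le_sin (abs_nonneg z.arg) harg
  have h2 : Real.sin |z.arg| = |z.im| / ‖z‖ := by
    rcases abs_cases z.arg with ⟨h, h'⟩ | ⟨h, h'⟩
    · rw [h, Complex.sin_arg, abs_of_nonneg (Complex.arg_nonneg_iff.1 h')]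
    · rw [h, Real.sin_neg, Complex.sin_arg, abs_of_neg (Complex.arg_neg_iff.1 h'), neg_div]
  have h3 : |z.im| / ‖z‖ ≤ c * ‖z‖ ^ (p - 1) := by
    rw [div_le_iff₀ hz, mul_assoc, Real.rpow_sub_one hz.ne', div_mul_cancel₀ _ hz.ne']
    exact him.le.trans (by gcongr; exact Complex.re_le_norm z)
  rw [h2] at h1
  have h4 := h1.trans h3
  calc |z.arg| = Real.pi / 2 * (2 / Real.pi * |z.arg|) := by field_simp
    _ ≤ Real.pi / 2 * (c * ‖z‖ ^ (p - 1)) := by gcongr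
    _ = _ := by ring

/-- A holomorphic map from a disc into a cusp of order `p` can only take values of size `r` in an
exponentially thin boundary layer. -/
lemma exists_boundary_layer_bound {f : ℂ → ℂ} {R c p : ℝ} (hR : 0 < R) (hc : 0 < c) (hp : 1 < p)
    (hf : DifferentiableOn ℂ f (Metric.ball 0 R))
    (hmaps : MapsTo f (Metric.ball 0 R) {z : ℂ | 0 < z.re ∧ |z.im| < c * z.re ^ p}) :
    ∃ A a r₀ : ℝ, 0 < A ∧ 0 < a ∧ 0 < r₀ ∧ ∀ w ∈ Metric.ball (0 : ℂ) R, ‖f w‖ ≤ r₀ →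
      R - ‖w‖ ≤ A * Real.exp (-a / ‖f w‖ ^ (p - 1)) := by
  have hπ := Real.pi_pos
  have hp1 : 0 < p - 1 := sub_pos.2 hp
  set B : ℝ := (p - 1) * (Real.pi / 2 * c) with hB
  have hB0 : 0 < B := by positivity
  have hfne : ∀ w ∈ Metric.ball (0 : ℂ) R, f w ≠ 0 := fun w hw h ↦ by
    simpa [h] using (hmaps hw).1
  have hangle : ∀ w ∈ Metric.ball (0 : ℂ) R,
      |(f w).arg * (1 - p)| ≤ B * ‖f w‖ ^ (p - 1) := fun w hw ↦ by
    rw [abs_mul, abs_sub_comm, abs_of_pos hp1, hB, mul_comm]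
    calc (p - 1) * |(f w).arg| ≤ (p - 1) * (Real.pi / 2 * c * ‖f w‖ ^ (p - 1)) := by
          gcongr
          exact abs_arg_le_of_mem_cusp hc hp (hmaps hw).1 (hmaps hw).2
      _ = _ := by ring
  have hpow : ∀ w ∈ Metric.ball (0 : ℂ) R, ‖f w‖ ^ (1 - p) * ‖f w‖ ^ (p - 1) = 1 := fun w hw ↦ by
    rw [← Real.rpow_add (norm_pos_iff.2 (hfne w hw))]
    simp
  have hcpow : ∀ w ∈ Metric.ball (0 : ℂ) R, f w ^ (1 - p : ℂ) =
      ((‖f w‖ ^ (1 - p) * Real.cos ((f w).arg * (1 - p)) : ℝ) : ℂ) +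
      ((‖f w‖ ^ (1 - p) * Real.sin ((f w).arg * (1 - p)) : ℝ) : ℂ) * Complex.I := fun w hw ↦ by
    have := Complex.cpow_ofReal (f w) (1 - p)
    push_cast at this ⊢
    rw [this]
    ring
  set F : ℂ → ℂ := fun w ↦ Complex.exp ((1 / B : ℝ) * f w ^ (1 - p : ℂ)) with hF
  have hFd : DifferentiableOn ℂ F (Metric.ball 0 R) :=
    ((hf.cpow_const fun w hw ↦ Or.inl (hmaps hw).1).const_mul _).cexp
  have hFpos : ∀ w ∈ Metric.ball (0 : ℂ) R, 0 < (F w).re := by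
    intro w hw
    have him : |((1 / B : ℝ) * f w ^ (1 - p : ℂ)).im| ≤ 1 := by
      have e : ((1 / B : ℝ) * f w ^ (1 - p : ℂ)).im =
          1 / B * (‖f w‖ ^ (1 - p) * Real.sin ((f w).arg * (1 - p))) := by
        rw [hcpow w hw, Complex.im_ofReal_mul, Complex.add_im, Complex.ofReal_im,
          Complex.im_ofReal_mul, Complex.I_im, zero_add, mul_one]
      rw [e, abs_mul, abs_mul, abs_of_pos (one_div_pos.2 hB0),
        abs_of_nonneg (Real.rpow_nonneg (norm_nonneg _) _)]
      calc _ ≤ 1 / B * (‖f w‖ ^ (1 - p) * (B * ‖f w‖ ^ (p - 1))) := by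
            gcongr
            exact Real.abs_sin_le_abs.trans (hangle w hw)
        _ = 1 / B * B * (‖f w‖ ^ (1 - p) * ‖f w‖ ^ (p - 1)) := by ring
        _ = 1 := by rw [hpow w hw, one_div_mul_cancel hB0.ne', one_mul]
    rw [hF]
    simp only [Complex.exp_re]
    refine mul_pos (Real.exp_pos _) (Real.cos_pos_of_mem_Ioo ?_)
    have := abs_le.1 him
    constructor <;> linarith [Real.pi_gt_three]
  refine ⟨4 * R * ‖F 0‖, 1 / (2 * B), (1 / B) ^ (1 / (p - 1)), ?_, by positivity, by positivity,
    fun w hw hwr ↦ ?_⟩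
  · have : F 0 ≠ 0 := Complex.exp_ne_zero _
    positivity
  have hn0 : 0 < ‖f w‖ := norm_pos_iff.2 (hfne w hw)
  have hsmall : B * ‖f w‖ ^ (p - 1) ≤ 1 := by
    have := Real.rpow_le_rpow hn0.le hwr hp1.le
    rw [← Real.rpow_mul (by positivity), one_div_mul_cancel hp1.ne', Real.rpow_one,
      le_div_iff₀ hB0] at this
    linarith
  have hcos : 1 / 2 ≤ Real.cos ((f w).arg * (1 - p)) := by
    have h1 := (hangle w hw).trans hsmall
    have := Real.one_sub_sq_div_two_le_cos (x := (f w).arg * (1 - p))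
    have h2 := sq_le_one_iff_abs_le_one _ |>.2 h1
    linarith
  have hFn : Real.exp (1 / (2 * B) / ‖f w‖ ^ (p - 1)) ≤ ‖F w‖ := by
    rw [hF]
    simp only [Complex.norm_exp]
    rw [Real.exp_le_exp, Complex.re_ofReal_mul, hcpow w hw, Complex.add_re, Complex.ofReal_re,
      Complex.re_ofReal_mul, Complex.I_re, mul_zero, add_zero]
    have e : 1 / (2 * B) / ‖f w‖ ^ (p - 1) = 1 / B * (‖f w‖ ^ (1 - p) * (1 / 2)) := by
      rw [eq_div_of_mul_eq (by positivity) (hpow w hw)]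
      field_simp
    rw [e]
    gcongr
  have hmain := norm_le_of_re_pos hR hFd hFpos hw
  have hwR : 0 ≤ R - ‖w‖ := (sub_pos.2 (mem_ball_zero_iff.1 hw)).le
  rw [neg_div, Real.exp_neg, ← div_eq_mul_inv, le_div_iff₀ (Real.exp_pos _), mul_comm]
  exact (mul_le_mul_of_nonneg_right hFn hwR).trans hmain

/-- The complement of a connected subset of a Jordan curve is connected. -/
lemma isPreconnected_range_diff (γ : C(Metric.sphere (0 : ℂ) 1, ℂ))
    (hγ : Function.Injective γ) {K : Set ℂ} (hK : IsPreconnected K) (hKγ : K ⊆ range γ) :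
    IsPreconnected (range γ \ K) := by
  rcases (range γ \ K).eq_empty_or_nonempty with h | ⟨_, ⟨u, rfl⟩, hu⟩
  · rw [h]; exact isPreconnected_empty
  have hun : ‖(u : ℂ)‖ = 1 := mem_sphere_zero_iff_norm.1 u.2
  have hu0 : (u : ℂ) ≠ 0 := norm_pos_iff.1 (by rw [hun]; exact one_pos)
  have hmem : ∀ θ : ℝ, -(u : ℂ) * Complex.exp (θ * Complex.I) ∈ Metric.sphere (0 : ℂ) 1 :=
    fun θ ↦ by simp [hun, Complex.norm_exp_ofReal_mul_I]
  set e : ℝ → Metric.sphere (0 : ℂ) 1 := fun θ ↦ ⟨_, hmem θ⟩ with he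
  have hec : Continuous e := by
    refine Continuous.subtype_mk ?_ _
    fun_prop
  set σ : Metric.sphere (0 : ℂ) 1 → ℝ := fun x ↦ Complex.arg (-x / u) with hσ
  have heσ : ∀ x, e (σ x) = x := by
    intro x
    have hx : ‖(-x / u : ℂ)‖ = 1 := by simp [hun]
    have := Complex.norm_mul_exp_arg_mul_I (-x / u : ℂ)
    rw [hx] at this
    apply Subtype.ext
    simp only [he, hσ]
    push_cast at this
    rw [one_mul] at this
    rw [this]
    field_simp
  have hepi : e Real.pi = u ∧ e (-Real.pi) = u := by
    constructor <;> apply Subtype.ext <;> simp [he, Complex.exp_neg]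
  have hσu : ∀ x, x ≠ u → (-x / u : ℂ) ∈ Complex.slitPlane := by
    intro x hx
    rw [Complex.mem_slitPlane_iff_arg]
    refine ⟨fun h ↦ hx ?_, ?_⟩
    · rw [← heσ x]
      exact (congrArg e h).trans hepi.1
    · have hx0 : (x : ℂ) ≠ 0 := norm_pos_iff.1
        (by rw [mem_sphere_zero_iff_norm.1 x.2]; exact one_pos)
      simp [hu0, hx0]
  set T : Set ℝ := σ '' (γ ⁻¹' K) with hT
  have hKne : ∀ x ∈ γ ⁻¹' K, x ≠ u := fun x hx h ↦ hu (h ▸ hx)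
  have hTc : IsPreconnected T := by
    have h1 : IsPreconnected (γ ⁻¹' K) := by
      rw [← (γ.continuous.isClosedEmbedding hγ).isInducing.isPreconnected_image,
        image_preimage_eq_of_subset hKγ]
      exact hK
    refine h1.image _ fun x hx ↦ ContinuousAt.continuousWithinAt ?_
    have : ContinuousAt (fun x : Metric.sphere (0 : ℂ) 1 ↦ (-x / u : ℂ)) x := by fun_prop
    exact ContinuousAt.comp (f := fun x : Metric.sphere (0 : ℂ) 1 ↦ (-x / u : ℂ))
      (Complex.continuousAt_arg (hσu x (hKne x hx))) this
  have hTlt : ∀ τ ∈ T, -Real.pi < τ ∧ τ < Real.pi := by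
    rintro _ ⟨x, hx, rfl⟩
    exact ⟨Complex.neg_pi_lt_arg _, lt_of_le_of_ne (Complex.arg_le_pi _)
      (Complex.mem_slitPlane_iff_arg.1 (hσu x (hKne x hx))).1⟩
  set A : Set ℝ := {θ | -Real.pi ≤ θ ∧ θ ≤ Real.pi ∧ ∀ τ ∈ T, θ < τ}
  set B : Set ℝ := {θ | -Real.pi ≤ θ ∧ θ ≤ Real.pi ∧ ∀ τ ∈ T, τ < θ}
  have hA : IsPreconnected A := by
    refine OrdConnected.isPreconnected ⟨fun x hx y hy z hz ↦ ?_⟩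
    exact ⟨hx.1.trans hz.1, hz.2.trans hy.2.1, fun τ hτ ↦ hz.2.trans_lt (hy.2.2 τ hτ)⟩
  have hB : IsPreconnected B := by
    refine OrdConnected.isPreconnected ⟨fun x hx y hy z hz ↦ ?_⟩
    exact ⟨hx.1.trans hz.1, hz.2.trans hy.2.1, fun τ hτ ↦ (hx.2.2 τ hτ).trans_le hz.1⟩
  have hc : Continuous fun θ ↦ γ (e θ) := γ.continuous.comp hec
  have hEq : range γ \ K = (fun θ ↦ γ (e θ)) '' A ∪ (fun θ ↦ γ (e θ)) '' B := by
    apply Subset.antisymm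
    · rintro _ ⟨⟨x, rfl⟩, hx⟩
      have hnot : σ x ∉ T := by
        rintro ⟨y, hy, hyx⟩
        have : y = x := by rw [← heσ y, hyx, heσ x]
        exact hx (this ▸ hy)
      have hAB : σ x ∈ A ∨ σ x ∈ B := by
        by_contra! hcon
        have h1 : ∃ τ ∈ T, τ ≤ σ x := by
          by_contra! h
          exact hcon.1 ⟨(Complex.neg_pi_lt_arg _).le, Complex.arg_le_pi _, h⟩
        have h2 : ∃ τ ∈ T, σ x ≤ τ := by
          by_contra! h
          exact hcon.2 ⟨(Complex.neg_pi_lt_arg _).le, Complex.arg_le_pi _, h⟩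
        obtain ⟨τ₁, hτ₁, h1⟩ := h1
        obtain ⟨τ₂, hτ₂, h2⟩ := h2
        exact hnot (hTc.ordConnected.out hτ₁ hτ₂ ⟨h1, h2⟩)
      rcases hAB with h | h
      · exact Or.inl ⟨σ x, h, by simp only [heσ]⟩
      · exact Or.inr ⟨σ x, h, by simp only [heσ]⟩
    · have hout : ∀ θ, -Real.pi ≤ θ → θ ≤ Real.pi → γ (e θ) ∈ K → θ ∈ T := by
        intro θ h1 h2 hK'
        have hne := hKne _ hK'
        have hlt : -Real.pi < θ := lt_of_le_of_ne h1 fun h ↦ hne (h ▸ hepi.2)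
        refine ⟨e θ, hK', ?_⟩
        have : (-(e θ : ℂ) / u : ℂ) = Complex.exp (θ * Complex.I) := by
          simp only [he]
          field_simp
        simp only [hσ, this]
        rw [Complex.arg_exp_mul_I, toIocMod_eq_self]
        exact ⟨hlt, by linarith⟩
      rintro _ (⟨θ, hθ, rfl⟩ | ⟨θ, hθ, rfl⟩)
      · exact ⟨mem_range_self _, fun h ↦ lt_irrefl _ (hθ.2.2 θ (hout θ hθ.1 hθ.2.1 h))⟩
      · exact ⟨mem_range_self _, fun h ↦ lt_irrefl _ (hθ.2.2 θ (hout θ hθ.1 hθ.2.1 h))⟩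
  have hπ := Real.pi_pos
  rw [hEq]
  refine IsPreconnected.union (γ u) ⟨-Real.pi, ⟨le_rfl, by linarith, fun τ hτ ↦ (hTlt τ hτ).1⟩, ?_⟩
    ⟨Real.pi, ⟨by linarith, le_rfl, fun τ hτ ↦ (hTlt τ hτ).2⟩, ?_⟩
    (hA.image _ hc.continuousOn) (hB.image _ hc.continuousOn)
  · simp only [hepi.2]
  · simp only [hepi.1]

lemma IsQuasismoothArcFromZero.isCompact {Γ : Set ℂ} (h : IsQuasismoothArcFromZero Γ) :
    IsCompact Γ := by
  obtain ⟨γ, hc, -, rfl, -⟩ := h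
  exact isCompact_Icc.image_of_continuousOn hc

lemma IsQuasismoothArcFromZero.zero_mem {Γ : Set ℂ} (h : IsQuasismoothArcFromZero Γ) :
    (0 : ℂ) ∈ Γ := by
  obtain ⟨γ, -, -, rfl, h0, -⟩ := h
  exact ⟨0, ⟨le_rfl, zero_le_one⟩, h0⟩

/-- The points of a quasismooth arc close to the origin lie in a connected piece of the arc of
comparable diameter. -/
lemma IsQuasismoothArcFromZero.exists_isPreconnected {Γ : Set ℂ}
    (h : IsQuasismoothArcFromZero Γ) :
    ∃ M : ℝ, 1 ≤ M ∧ ∀ r > 0, ∃ K : Set ℂ, IsPreconnected K ∧ 0 ∈ K ∧ K ⊆ Γ ∧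
      Γ ∩ Metric.ball 0 r ⊆ K ∧ K ⊆ Metric.closedBall 0 (M * r) := by
  obtain ⟨γ, hc, -, rfl, h0, M, hM, hlen⟩ := h
  have hz : (0 : ℝ) ∈ Icc (0 : ℝ) 1 := ⟨le_rfl, zero_le_one⟩
  refine ⟨M, hM, fun r hr ↦ ⟨⋃ a ∈ {a ∈ Icc (0 : ℝ) 1 | ‖γ a‖ < r}, γ '' Icc 0 a,
    ?_, ?_, ?_, ?_, ?_⟩⟩
  · rw [← sUnion_image]
    refine isPreconnected_sUnion 0 _ ?_ ?_
    · rintro _ ⟨a, ha, rfl⟩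
      exact ⟨0, ⟨le_rfl, ha.1.1⟩, h0⟩
    · rintro _ ⟨a, ha, rfl⟩
      exact isPreconnected_Icc.image _ (hc.mono (Icc_subset_Icc_right ha.1.2))
  · exact mem_biUnion (⟨hz, by simpa [h0] using hr⟩ : (0 : ℝ) ∈ {a ∈ Icc (0 : ℝ) 1 | ‖γ a‖ < r})
      ⟨0, ⟨le_rfl, le_rfl⟩, h0⟩
  · exact iUnion₂_subset fun a ha ↦ image_mono (Icc_subset_Icc_right ha.1.2)
  · rintro _ ⟨⟨a, ha, rfl⟩, har⟩
    exact mem_biUnion (⟨ha, mem_ball_zero_iff.1 har⟩ : a ∈ {a ∈ Icc (0 : ℝ) 1 | ‖γ a‖ < r})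
      ⟨a, ⟨ha.1, le_rfl⟩, rfl⟩
  · refine iUnion₂_subset fun a ha ↦ ?_
    rintro _ ⟨b, hb, rfl⟩
    have h1 := (eVariationOn.edist_le γ hb (left_mem_Icc.2 ha.1.1)).trans
      (hlen 0 hz a ha.1 ha.1.1)
    rw [h0, sub_zero, edist_dist, ENNReal.ofReal_le_ofReal_iff (by positivity)] at h1
    rw [Metric.mem_closedBall]
    refine h1.trans ?_
    gcongr
    exact ha.2.le

/-- If a Jordan curve consists of two quasismooth arcs emanating from the origin, then it has
connected closed pieces that avoid a disc around the origin and contain all points of the curve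
outside a disc of comparable radius. -/
lemma exists_isPreconnected_avoiding_ball (γ : C(Metric.sphere (0 : ℂ) 1, ℂ))
    (hγ : Function.Injective γ) {Γ₁ Γ₂ : Set ℂ} (h₁ : IsQuasismoothArcFromZero Γ₁)
    (h₂ : IsQuasismoothArcFromZero Γ₂) (hΓ : range γ = Γ₁ ∪ Γ₂) :
    ∃ M : ℝ, 1 ≤ M ∧ ∀ r > 0, ∃ P : Set ℂ, IsClosed P ∧ IsPreconnected P ∧ P ⊆ range γ ∧
      Disjoint (Metric.ball 0 r) P ∧ ∀ z ∈ range γ, M * r < ‖z‖ → z ∈ P := by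
  obtain ⟨M₁, hM₁, hK₁⟩ := h₁.exists_isPreconnected
  obtain ⟨M₂, hM₂, hK₂⟩ := h₂.exists_isPreconnected
  refine ⟨max M₁ M₂, hM₁.trans (le_max_left _ _), fun r hr ↦ ?_⟩
  obtain ⟨K₁, c₁, z₁, s₁, b₁, d₁⟩ := hK₁ r hr
  obtain ⟨K₂, c₂, z₂, s₂, b₂, d₂⟩ := hK₂ r hr
  have hK : IsPreconnected (K₁ ∪ K₂) := c₁.union 0 z₁ z₂ c₂
  have hKγ : K₁ ∪ K₂ ⊆ range γ := hΓ ▸ union_subset_union s₁ s₂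
  have hcl : IsClosed (range γ) := (isCompact_range γ.continuous).isClosed
  refine ⟨closure (range γ \ (K₁ ∪ K₂)), isClosed_closure,
    (isPreconnected_range_diff γ hγ hK hKγ).closure, closure_minimal sdiff_subset hcl, ?_, ?_⟩
  · refine Disjoint.closure_right ?_ Metric.isOpen_ball
    rw [disjoint_left]
    rintro z hz ⟨hzγ, hzK⟩
    rw [hΓ] at hzγ
    rcases hzγ with h | h
    · exact hzK (Or.inl (b₁ ⟨h, hz⟩))
    · exact hzK (Or.inr (b₂ ⟨h, hz⟩))
  · refine fun z hz hzr ↦ subset_closure ⟨hz, fun hzK ↦ hzr.not_ge ?_⟩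
    rcases hzK with h | h
    · exact (mem_closedBall_zero_iff.1 (d₁ h)).trans (by gcongr; exact le_max_left _ _)
    · exact (mem_closedBall_zero_iff.1 (d₂ h)).trans (by gcongr; exact le_max_right _ _)

/-- A bounded set whose frontier lies in a disc is contained in this disc. -/
lemma subset_ball_of_frontier_subset {G : Set ℂ} {R : ℝ} (hb : Bornology.IsBounded G)
    (hf : frontier G ⊆ Metric.ball 0 R) : G ⊆ Metric.ball 0 R := by
  intro z hz
  by_contra hzR
  rw [mem_ball_zero_iff, not_lt] at hzR
  rcases eq_or_ne z 0 with rfl | hz0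
  · rw [norm_zero] at hzR
    have hfe : frontier G = ∅ := subset_empty_iff.1 (hf.trans (Metric.ball_eq_empty.2 hzR).subset)
    rcases frontier_eq_empty_iff.1 hfe with h | h
    · rw [h] at hz; exact hz
    · exact NormedSpace.unbounded_univ ℝ ℂ (h ▸ hb)
  have hpre : IsPreconnected ((fun s : ℝ ↦ (s : ℂ) * z) '' Ici 1) :=
    isPreconnected_Ici.image _ (by fun_prop)
  obtain ⟨B, hB⟩ := hb.subset_ball 0
  have hzn := norm_pos_iff.2 hz0
  obtain ⟨_, ⟨s, hs, rfl⟩, hsf⟩ : (((fun s : ℝ ↦ (s : ℂ) * z) '' Ici 1) ∩ frontier G).Nonempty := by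
    by_contra hcon
    have hnf : ∀ x ∈ (fun s : ℝ ↦ (s : ℂ) * z) '' Ici 1, x ∈ closure G → x ∈ interior G :=
      fun x hx hxc ↦ by_contra fun hxi ↦ hcon ⟨x, hx, hxc, hxi⟩
    have hfar : max 1 (B / ‖z‖) ∈ Ici (1 : ℝ) := mem_Ici.2 (le_max_left _ _)
    have hcl : (max 1 (B / ‖z‖) : ℝ) * z ∈ (closure G)ᶜ := fun hcl ↦ by
      have h1 := mem_ball_zero_iff.1 (hB (interior_subset (hnf _ ⟨_, hfar, rfl⟩ hcl)))
      rw [norm_mul, Complex.norm_real, Real.norm_of_nonneg (by positivity)] at h1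
      have h2 : B / ‖z‖ * ‖z‖ ≤ max 1 (B / ‖z‖) * ‖z‖ := by
        gcongr; exact le_max_right _ _
      rw [div_mul_cancel₀ _ hzn.ne'] at h2
      linarith
    obtain ⟨x, -, hxi, hxc⟩ := hpre (interior G) (closure G)ᶜ isOpen_interior
      isClosed_closure.isOpen_compl (fun x hx ↦ (em (x ∈ closure G)).imp_left (hnf x hx))
      ⟨z, ⟨1, self_mem_Ici, by simp⟩, hnf z ⟨1, self_mem_Ici, by simp⟩ (subset_closure hz)⟩
      ⟨_, ⟨_, hfar, rfl⟩, hcl⟩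
    exact hxc (interior_subset_closure hxi)
  have h1 := mem_ball_zero_iff.1 (hf hsf)
  have hs1 : (1 : ℝ) ≤ s := hs
  rw [norm_mul, Complex.norm_real, Real.norm_of_nonneg (by linarith)] at h1
  nlinarith

lemma frontier_subset_ball_of_arcs (γ : C(Metric.sphere (0 : ℂ) 1, ℂ)) {Γ₁ Γ₂ : Set ℂ} {R : ℝ}
    (h₁ : IsQuasismoothArcFromZero Γ₁) (h₂ : IsQuasismoothArcFromZero Γ₂)
    (hΓ : range γ ∩ Metric.ball 0 R = Γ₁ ∪ Γ₂) : range γ ⊆ Metric.ball 0 R := by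
  have hsph : IsPreconnected (Metric.sphere (0 : ℂ) 1) :=
    isPreconnected_sphere (by simp [Complex.rank_real_complex]) _ _
  have : PreconnectedSpace (Metric.sphere (0 : ℂ) 1) := isPreconnected_iff_preconnectedSpace.1 hsph
  have hcl : IsClosed (Γ₁ ∪ Γ₂) := (h₁.isCompact.union h₂.isCompact).isClosed
  have hclopen : IsClopen (γ ⁻¹' Metric.ball 0 R) := by
    refine ⟨?_, Metric.isOpen_ball.preimage γ.continuous⟩
    have : γ ⁻¹' Metric.ball 0 R = γ ⁻¹' (Γ₁ ∪ Γ₂) := by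
      rw [← hΓ, preimage_inter, preimage_range, univ_inter]
    rw [this]
    exact hcl.preimage γ.continuous
  have h0 : (0 : ℂ) ∈ range γ ∩ Metric.ball 0 R := hΓ ▸ Or.inl h₁.zero_mem
  obtain ⟨⟨x, hx⟩, hxR⟩ := h0
  have := hclopen.eq_univ ⟨x, by rwa [mem_preimage, hx]⟩
  rintro _ ⟨y, rfl⟩
  exact (this ▸ mem_univ y : y ∈ γ ⁻¹' Metric.ball 0 R)

lemma norm_eq_of_frontier {G : Set ℂ} {ψ f : ℂ → ℂ} {R : ℝ} (hGo : IsOpen G)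
    (hψ : ContinuousOn ψ (closure G)) (hψm : MapsTo ψ G (Metric.ball 0 R))
    (hf : ContinuousOn f (Metric.ball 0 R)) (hfm : MapsTo f (Metric.ball 0 R) G)
    (hfψ : ∀ z ∈ G, f (ψ z) = z) {z : ℂ} (hz : z ∈ frontier G) : ‖ψ z‖ = R := by
  have hzc := frontier_subset_closure hz
  have hne : (𝓝[G] z).NeBot := mem_closure_iff_nhdsWithin_neBot.1 hzc
  have ht : Tendsto ψ (𝓝[G] z) (𝓝 (ψ z)) := (hψ z hzc).mono_left (nhdsWithin_mono _ subset_closure)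
  refine le_antisymm ?_ (not_lt.1 fun hlt ↦ ?_)
  · refine le_of_tendsto ht.norm ?_
    filter_upwards [self_mem_nhdsWithin] with x hx using (mem_ball_zero_iff.1 (hψm hx)).le
  · have hb : ψ z ∈ Metric.ball (0 : ℂ) R := mem_ball_zero_iff.2 hlt
    have h1 : Tendsto (fun x ↦ f (ψ x)) (𝓝[G] z) (𝓝 (f (ψ z))) :=
      (hf.continuousAt (Metric.isOpen_ball.mem_nhds hb)).tendsto.comp ht
    have h2 : Tendsto (fun x ↦ f (ψ x)) (𝓝[G] z) (𝓝 z) := by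
      refine (tendsto_id.mono_left nhdsWithin_le_nhds : Tendsto id (𝓝[G] z) (𝓝 z)).congr' ?_
      filter_upwards [self_mem_nhdsWithin] with x hx using (hfψ x hx).symm
    have h3 : z ∈ G := tendsto_nhds_unique h1 h2 ▸ hfm hb
    exact (hGo.inter_frontier_eq.subset ⟨h3, hz⟩ : z ∈ (∅ : Set ℂ))

/-- If the inverse of a conformal map `ψ : G → ball 0 R` only takes small values in a thin boundary
layer, and the part of the boundary of `G` away from the origin is connected in a suitable sense,
then `ψ` maps points close to the origin close to `ψ 0`. -/
lemma norm_sub_le_of_boundary_layer {G P : Set ℂ} {ψ f : ℂ → ℂ} {R r ρ η : ℝ} (hR : 0 < R)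
    (hGo : IsOpen G) (hG : IsPreconnected G) (h0 : (0 : ℂ) ∈ frontier G)
    (hψ : ContinuousOn ψ (closure G)) (hψm : MapsTo ψ G (Metric.ball 0 R))
    (hf : DifferentiableOn ℂ f (Metric.ball 0 R)) (hfm : MapsTo f (Metric.ball 0 R) G)
    (hfψ : ∀ z ∈ G, f (ψ z) = z) (hψf : ∀ w ∈ Metric.ball 0 R, ψ (f w) = w)
    (hre : ∀ z ∈ G, 0 < z.re) (hr : 0 < r) (hrρ : r ≤ ρ) (hη : 0 < η)
    (hlayer : ∀ w ∈ Metric.ball (0 : ℂ) R, ‖f w‖ ≤ 5 * ρ → R - ‖w‖ ≤ η)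
    (hPc : IsClosed P) (hP : IsPreconnected P) (hPG : P ⊆ frontier G)
    (hPr : Disjoint (Metric.ball 0 r) P) (hPρ : frontier G ∩ Metric.sphere 0 ρ ⊆ P) {t : ℂ}
    (ht : t ∈ G) (htr : ‖t‖ < r) : ‖ψ t - ψ 0‖ ≤ 2 * Real.exp (16 * Real.pi ^ 2) * η := by
  have hρ : 0 < ρ := hr.trans_le hrρ
  have hζ : ‖ψ 0‖ = R := norm_eq_of_frontier hGo hψ hψm hf.continuousOn hfm hfψ h0
  have h0c := frontier_subset_closure h0
  have hne : ∀ w ∈ Metric.ball (0 : ℂ) R, ρ ≤ ‖f w + ρ‖ := fun w hw ↦ by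
    have h1 := Complex.re_le_norm (f w + ρ)
    simp only [Complex.add_re, Complex.ofReal_re] at h1
    linarith [hre _ (hfm hw)]
  have hne' : ∀ w ∈ Metric.ball (0 : ℂ) R, f w + ρ ≠ 0 := fun w hw ↦
    norm_pos_iff.1 (hρ.trans_le (hne w hw))
  set k : ℂ → ℂ := fun w ↦ ρ / (f w + ρ) with hk
  have hkn : ∀ w, ‖k w‖ = ρ / ‖f w + ρ‖ := fun w ↦ by
    rw [hk]
    simp only [norm_div, Complex.norm_real, Real.norm_of_nonneg hρ.le]
  have hρC : (ρ : ℂ) ≠ 0 := Complex.ofReal_ne_zero.2 hρ.ne'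
  have key : min ‖ψ t - ψ 0‖ R ≤ Real.exp (16 * Real.pi ^ 2) * η := by
    refine le_exp_mul_of_oscillation (k := k) hη hR hζ ?_ ?_ ?_ ?_
    · exact (differentiableOn_const _).div (hf.add_const _) hne'
    · intro v hv w hw hvw
      have h1 : (ρ : ℂ) / (f v + ρ) = ρ / (f w + ρ) := hvw
      rw [div_eq_div_iff (hne' v hv) (hne' w hw)] at h1
      have h2 := add_right_cancel (mul_left_cancel₀ hρC h1)
      rw [← hψf v hv, ← hψf w hw, h2]
    · intro w hw
      rw [mem_closedBall_zero_iff, hkn]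
      exact div_le_one_of_le₀ (hne w hw) (norm_nonneg _)
    · rintro x ⟨hηx, hxδ⟩
      have hx0 := hη.trans hηx
      have hxR : x < R := hxδ.trans_le (min_le_right _ _)
      have hxt : x < ‖ψ t - ψ 0‖ := hxδ.trans_le (min_le_left _ _)
      set m : ℂ := ψ 0 * (1 - (x / R : ℝ)) with hm
      have hmn : ‖m‖ = R - x := by
        have : ((1 : ℂ) - (x / R : ℝ)) = ((1 - x / R : ℝ) : ℂ) := by push_cast; ring
        rw [hm, this, norm_mul, hζ, Complex.norm_real, Real.norm_of_nonneg, mul_sub, mul_one,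
          mul_div_cancel₀ _ hR.ne']
        rw [sub_nonneg]
        exact div_le_one_of_le₀ hxR.le hR.le
      have hmb : m ∈ Metric.ball (0 : ℂ) R := by
        rw [mem_ball_zero_iff, hmn]; linarith
      have hfm5 : 5 * ρ < ‖f m‖ := by
        by_contra! h
        have := hlayer m hmb h
        linarith
      have hkm : ‖k m‖ ≤ 1 / 4 := by
        rw [hkn, div_le_iff₀ (hρ.trans_le (hne m hmb))]
        have h1 := norm_sub_le_norm_add (f m) (ρ : ℂ)
        rw [Complex.norm_real, Real.norm_of_nonneg hρ.le] at h1
        linarith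
      obtain ⟨v, hv, hvx, hvρ⟩ : ∃ v ∈ Metric.ball (0 : ℂ) R, ‖v - ψ 0‖ = x ∧ ‖f v‖ < ρ := by
        by_contra! hcon
        have hmem : ∀ z ∈ G, z ∈ Metric.ball (0 : ℂ) ρ → ‖ψ z - ψ 0‖ ≠ x := fun z hz hzρ h ↦ by
          have := hcon (ψ z) (hψm hz) h
          rw [hfψ z hz] at this
          exact this.not_gt (mem_ball_zero_iff.1 hzρ)
        have hev : ∀ᶠ z in 𝓝[G] (0 : ℂ), z ∈ G ∧ z ∈ Metric.ball (0 : ℂ) r ∧ ‖ψ z - ψ 0‖ < x := by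
          have h1 : Tendsto (fun z ↦ ‖ψ z - ψ 0‖) (𝓝[G] 0) (𝓝 ‖ψ 0 - ψ 0‖) :=
            (((hψ 0 h0c).mono_left (nhdsWithin_mono _ subset_closure)).sub_const _).norm
          rw [sub_self, norm_zero] at h1
          filter_upwards [self_mem_nhdsWithin, h1.eventually_lt_const hx0,
            mem_nhdsWithin_of_mem_nhds (Metric.ball_mem_nhds 0 hr)] with z h1 h2 h3
          exact ⟨h1, h3, h2⟩
        have : (𝓝[G] (0 : ℂ)).NeBot := mem_closure_iff_nhdsWithin_neBot.1 h0c
        obtain ⟨b, hbG, hbr, hbx⟩ := hev.exists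
        set U : Set ℂ := {z | z ∈ G ∧ z ∈ Metric.ball (0 : ℂ) ρ ∧ ‖ψ z - ψ 0‖ < x} with hU
        have hUG : closure U ⊆ closure G := closure_mono fun z hz ↦ hz.1
        have hUle : ∀ z ∈ closure U, ‖ψ z - ψ 0‖ ≤ x := fun z hz ↦ by
          have : (𝓝[U] z).NeBot := mem_closure_iff_nhdsWithin_neBot.1 hz
          have h1 : Tendsto (fun z ↦ ‖ψ z - ψ 0‖) (𝓝[U] z) (𝓝 ‖ψ z - ψ 0‖) :=
            (((hψ z (hUG hz)).mono_left
              (nhdsWithin_mono _ (subset_closure.trans hUG))).sub_const _).norm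
          refine le_of_tendsto h1 ?_
          filter_upwards [self_mem_nhdsWithin] with y hy using hy.2.2.le
        have hfr : frontier U ⊆ frontier G ∪ Metric.sphere 0 ρ := by
          intro z hz
          have hzU := frontier_subset_closure hz
          by_cases hzG : z ∈ G
          · right
            have hzρ : z ∈ Metric.closedBall (0 : ℂ) ρ :=
              closure_minimal (fun y hy ↦ Metric.ball_subset_closedBall hy.2.1)
                Metric.isClosed_closedBall hzU
            rw [mem_sphere_zero_iff_norm]
            refine le_antisymm (mem_closedBall_zero_iff.1 hzρ) (not_lt.1 fun hlt ↦ ?_)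
            have hzb : z ∈ Metric.ball (0 : ℂ) ρ := mem_ball_zero_iff.2 hlt
            have hzx := lt_of_le_of_ne (hUle z hzU) (hmem z hzG hzb)
            refine hz.2 (mem_interior_iff_mem_nhds.2 ?_)
            have hcont : ContinuousAt (fun z ↦ ‖ψ z - ψ 0‖) z :=
              ((hψ.continuousAt (mem_of_superset (hGo.mem_nhds hzG) subset_closure)).sub_const
                _).norm
            filter_upwards [hGo.mem_nhds hzG, Metric.isOpen_ball.mem_nhds hzb,
              hcont.eventually_lt_const hzx] with y h1 h2 h3
            exact ⟨h1, h2, h3⟩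
          · left
            exact ⟨hUG hzU, fun h ↦ hzG (interior_subset h)⟩
        have hbU : b ∈ U := ⟨hbG, Metric.ball_subset_ball hrρ hbr, hbx⟩
        have htU := mem_closure_of_frontier_subset hrρ hGo hG (fun z hz ↦ hz.2.1) hfr hPc hP hPG hPr
          hPρ hbU hbG hbr ht (mem_ball_zero_iff.2 htr)
        exact hxt.not_ge (hUle t htU)
      refine ⟨v, hv, hvx, ?_⟩
      have hkv : 1 / 2 ≤ ‖k v‖ := by
        rw [hkn, le_div_iff₀ (hρ.trans_le (hne v hv))]
        have h1 := norm_add_le (f v) (ρ : ℂ)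
        rw [Complex.norm_real, Real.norm_of_nonneg hρ.le] at h1
        linarith
      have h1 := norm_sub_norm_le (k v) (k m)
      linarith
  have hψt : ‖ψ t - ψ 0‖ ≤ 2 * R := by
    have := norm_sub_le (ψ t) (ψ 0)
    have h1 := mem_ball_zero_iff.1 (hψm ht)
    linarith
  rcases min_le_iff.1 key with h | h
  · have : 0 < Real.exp (16 * Real.pi ^ 2) * η := by positivity
    linarith
  · linarith

/-- An exponential bound at small scales extends to all scales. -/
lemma exists_exp_bound_of_small {G : Set ℂ} {u : ℂ → ℝ} {C c r B q : ℝ} (hC : 0 < C) (hc : 0 < c)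
    (hr : 0 < r) (hB : 0 < B) (hq : 0 < q) (hu : ContinuousOn u (closure G)) (hu0 : u 0 = 0)
    (hsmall : ∀ t ∈ G, t ≠ 0 → ‖t‖ ≤ r → u t ≤ C * Real.exp (-c / ‖t‖ ^ q))
    (hbig : ∀ t ∈ G, u t ≤ B) :
    ∃ D > 0, ∀ t ∈ closure G, u t ≤ D * Real.exp (-c / ‖t‖ ^ q) := by
  have hD : 0 < C + B * Real.exp (c / r ^ q) := by positivity
  have hmain : ∀ t ∈ G, t ≠ 0 →
      u t ≤ (C + B * Real.exp (c / r ^ q)) * Real.exp (-c / ‖t‖ ^ q) := by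
    intro t ht ht0
    rw [add_mul]
    rcases le_or_gt ‖t‖ r with h | h
    · exact (hsmall t ht ht0 h).trans (le_add_of_nonneg_right (by positivity))
    · refine le_trans ?_ (le_add_of_nonneg_left (by positivity))
      rw [mul_assoc, ← Real.exp_add]
      refine (hbig t ht).trans (le_mul_of_one_le_right hB.le (Real.one_le_exp ?_))
      rw [neg_div, ← sub_eq_add_neg, sub_nonneg]
      gcongr
  refine ⟨_, hD, fun t ht ↦ ?_⟩
  rcases eq_or_ne t 0 with rfl | ht0
  · rw [hu0]; positivity
  have hne : (𝓝[G] t).NeBot := mem_closure_iff_nhdsWithin_neBot.1 ht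
  have h1 : Tendsto u (𝓝[G] t) (𝓝 (u t)) := (hu t ht).mono_left (nhdsWithin_mono _ subset_closure)
  have hn : ‖t‖ ≠ 0 := norm_ne_zero_iff.2 ht0
  have h2 : ContinuousAt (fun t : ℂ ↦ (C + B * Real.exp (c / r ^ q)) *
      Real.exp (-c / ‖t‖ ^ q)) t := by
    have h3 : ContinuousAt (fun t : ℂ ↦ ‖t‖ ^ q) t :=
      continuous_norm.continuousAt.rpow_const (Or.inl hn)
    have h4 : ‖t‖ ^ q ≠ 0 := (Real.rpow_pos_of_pos (norm_pos_iff.2 ht0) _).ne'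
    exact (continuousAt_const.div h3 h4).rexp.const_mul _
  refine le_of_tendsto_of_tendsto h1 (h2.tendsto.mono_left nhdsWithin_le_nhds) ?_
  filter_upwards [self_mem_nhdsWithin, mem_nhdsWithin_of_mem_nhds (isOpen_ne.mem_nhds ht0)]
    with x hx hx0 using hmain x hx hx0

/-- **Exponential decay of the conformal map at an outward pointing cusp
(Theorem 3, estimate (3.1)).** If `G` has an `x^p`-type interior zero angle at
`0 ∈ ∂G`, formed by two quasismooth arcs, then the (continuous extension of
the) normalized conformal map `φ̂` satisfies
`|φ̂(t) − φ̂(0)| ≤ C exp(−c/|t|^{p−1})` on `cl G`. -/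
theorem conformal_map_exponential_decay_at_cusp
    (G : Set ℂ) (hG : IsJordanDomain G) (h0 : (0 : ℂ) ∈ frontier G)
    (z₀ : ℂ) (hz₀ : z₀ ∈ G)
    (φhat : ℂ → ℂ) (hφcont : ContinuousOn φhat (closure G))
    (R₀ : ℝ) (hR₀ : 0 < R₀)
    (hφdiff : DifferentiableOn ℂ φhat G)
    (hφbij : Set.BijOn φhat G (Metric.ball (0 : ℂ) R₀))
    (hφ0 : φhat z₀ = 0) (hφ1 : deriv φhat z₀ = 1)
    (R c₁ p : ℝ) (hR : 0 < R) (hc₁ : 0 < c₁) (hp : 1 < p)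
    (hcusp : G ∩ Metric.ball (0 : ℂ) R ⊆
      {z : ℂ | 0 < z.re ∧ |z.im| < c₁ * z.re ^ p})
    (hbdry : ∃ Γ₁ Γ₂ : Set ℂ, IsQuasismoothArcFromZero Γ₁ ∧
      IsQuasismoothArcFromZero Γ₂ ∧
      frontier G ∩ Metric.ball (0 : ℂ) R = Γ₁ ∪ Γ₂) :
    ∃ C c : ℝ, 0 < C ∧ 0 < c ∧ ∀ t ∈ closure G,
      ‖φhat t - φhat 0‖ ≤ C * Real.exp (-c / ‖t‖ ^ (p - 1)) := by
  obtain ⟨hGo, hGb, hGs, γ, hγ, hγG⟩ := hG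
  obtain ⟨Γ₁, Γ₂, h₁, h₂, hΓ⟩ := hbdry
  have hGc : IsPreconnected G := by
    rw [isPreconnected_iff_preconnectedSpace]; infer_instance
  have hfR : frontier G ⊆ Metric.ball 0 R := by
    rw [← hγG] at hΓ ⊢
    exact frontier_subset_ball_of_arcs γ h₁ h₂ hΓ
  have hGR : G ⊆ Metric.ball 0 R := subset_ball_of_frontier_subset hGb hfR
  rw [inter_eq_left.2 hfR] at hΓ
  rw [inter_eq_left.2 hGR] at hcusp
  obtain ⟨M, hM, hPex⟩ := exists_isPreconnected_avoiding_ball γ hγ h₁ h₂ (hγG.trans hΓ)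
  have hinv := hφbij.invOn_invFunOn
  set f := Function.invFunOn φhat G
  have hfm : MapsTo f (Metric.ball 0 R₀) G := hφbij.surjOn.mapsTo_invFunOn
  have hf : DifferentiableOn ℂ f (Metric.ball 0 R₀) :=
    differentiableOn_leftInverse hGo Metric.isOpen_ball hφdiff hφbij.injOn hfm hinv.2
  obtain ⟨A, a, r₀, hA, ha, hr₀, hlayer⟩ :=
    exists_boundary_layer_bound hR₀ hc₁ hp hf (hfm.mono_right hcusp)
  have hp1 : 0 < p - 1 := sub_pos.2 hp
  have hM0 : 0 < 10 * (M + 1) := by linarith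
  have hψm : MapsTo φhat G (Metric.ball 0 R₀) := hφbij.mapsTo
  have hζ := norm_eq_of_frontier hGo hφcont hψm hf.continuousOn hfm hinv.1 h0
  have hc : 0 < a / (10 * (M + 1)) ^ (p - 1) := by positivity
  suffices ∃ D > 0, ∀ t ∈ closure G, ‖φhat t - φhat 0‖ ≤
      D * Real.exp (-(a / (10 * (M + 1)) ^ (p - 1)) / ‖t‖ ^ (p - 1)) by
    obtain ⟨D, hD, hDt⟩ := this
    exact ⟨D, _, hD, hc, hDt⟩
  refine exists_exp_bound_of_small (u := fun t ↦ ‖φhat t - φhat 0‖)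
    (C := 2 * Real.exp (16 * Real.pi ^ 2) * A) (r := r₀ / (10 * (M + 1))) (B := 2 * R₀)
    (by positivity) hc (by positivity) (by positivity) hp1
    ((hφcont.sub continuousOn_const).norm) (by simp) ?_ ?_
  · intro t ht ht0 htr
    have htn := norm_pos_iff.2 ht0
    obtain ⟨P, hPc, hP, hPγ, hPr, hPfar⟩ := hPex (2 * ‖t‖) (by positivity)
    rw [hγG] at hPγ hPfar
    have htn' : 0 < M * ‖t‖ := by positivity
    rw [mul_assoc, neg_div, div_div, ← Real.mul_rpow hM0.le htn.le]
    have hρ : 5 * ((M + 1) * (2 * ‖t‖)) = 10 * (M + 1) * ‖t‖ := by ring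
    have hρr : 10 * (M + 1) * ‖t‖ ≤ r₀ := by
      rw [le_div_iff₀ hM0] at htr; linarith
    refine (norm_sub_le_of_boundary_layer (r := 2 * ‖t‖) (ρ := (M + 1) * (2 * ‖t‖))
      (η := A * Real.exp (-a / (10 * (M + 1) * ‖t‖) ^ (p - 1))) hR₀ hGo hGc h0 hφcont hψm hf hfm
      hinv.1 hinv.2 (fun z hz ↦ (hcusp hz).1) (by positivity) (by linarith) (by positivity)
      (fun w hw hwρ ↦ ?_) hPc hP hPγ hPr (fun z hz ↦ hPfar z hz.1 ?_) ht (by linarith)).trans_eq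
      (by rw [neg_div, mul_assoc])
    · rw [hρ] at hwρ
      refine (hlayer w hw (hwρ.trans hρr)).trans ?_
      have hfw : 0 < ‖f w‖ := norm_pos_iff.2 fun h ↦ by
        simpa [h] using (hcusp (hfm hw)).1
      rw [neg_div, neg_div]
      gcongr
    · rw [mem_sphere_zero_iff_norm.1 hz.2]
      linarith
  · intro t ht
    have h1 := mem_ball_zero_iff.1 (hψm ht)
    have h2 := norm_sub_le (φhat t) (φhat 0)
    linarith
end

section
/- Let G be a Jordan domain, z₀ ∈ G, let φ be the normalized conformal map of G with respect to z₀, and let B_n be the Bieberbach polynomials of G with respect to z₀. Assume: (i) there exist C, c > 0, r ∈ (0,1), and for each n ≥ 1 a polynomial p_n of degree at most n with sup_{z ∈ G} |φ'(z) − p_n(z)| ≤ C exp(−c n^r); and (ii) there exist A > 0 and P ≥ 1 such that for every n ≥ 1 and every polynomial Q of degree at most n with Q(z₀) = 0, sup_{z ∈ G} |Q(z)| ≤ A n^{P−1} (∫∫_G |Q'(z)|² dx dy)^{1/2}. Then there exist constants C' > 0, q ∈ (0,1) and r' ∈ (0,1) such that sup_{z ∈ G} |φ(z) − B_n(z)|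 ≤ C' q^{n^{r'}} for all n ≥ 1. -/
open MeasureTheory Filter

/-- `B` is an `n`-th Bieberbach polynomial of `G` with respect to `z₀`:
`deg B ≤ n`, `B(z₀) = 0`, `B'(z₀) = 1`, and `B` minimizes `∫∫_G |P'|²` among
all polynomials `P` of degree at most `n` with `P(z₀) = 0`, `P'(z₀) = 1`. -/
def IsBieberbachPoly (G : Set ℂ) (z₀ : ℂ) (n : ℕ) (B : Polynomial ℂ) : Prop :=
  B.natDegree ≤ n ∧ B.eval z₀ = 0 ∧ B.derivative.eval z₀ = 1 ∧
  ∀ P : Polynomial ℂ, P.natDegree ≤ n → P.eval z₀ = 0 → P.derivative.eval z₀ = 1 →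
    (∫ z in G, ‖B.derivative.eval z‖ ^ 2) ≤ ∫ z in G, ‖P.derivative.eval z‖ ^ 2

open Topology Set Metric

theorem integral_Ioo_eq_zero_of_differentiableOn_ball {R r : ℝ} {F : ℂ → ℂ}
    (hF : DifferentiableOn ℂ F (ball 0 R)) (hF0 : F 0 = 0) (hr : 0 < r) (hrR : r < R) :
    ∫ θ in Ioo (-Real.pi) Real.pi, F (circleMap 0 r θ) = 0 := by
  have hmean : Real.circleAverage F 0 r = F 0 := by
    refine DiffContOnCl.circleAverage (DifferentiableOn.diffContOnCl (hF.mono ?_))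
    rw [abs_of_pos hr, closure_ball _ hr.ne']
    exact closedBall_subset_ball hrR
  rw [hF0, Real.circleAverage_def, smul_eq_zero_iff_right (by positivity)] at hmean
  have hper : Function.Periodic (fun θ ↦ F (circleMap 0 r θ)) (2 * Real.pi) :=
    (periodic_circleMap 0 r).comp F
  have hshift := hper.intervalIntegral_add_eq 0 (-Real.pi)
  rw [zero_add, hmean, show -Real.pi + 2 * Real.pi = Real.pi by ring] at hshift
  rw [← integral_Ioc_eq_integral_Ioo,
    ← intervalIntegral.integral_of_le (by linarith [Real.pi_pos]), ← hshift]

/-- A holomorphic function on a disc that vanishes at the centre has zero area integral. -/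
theorem integral_ball_eq_zero_of_differentiableOn {R : ℝ} {F : ℂ → ℂ}
    (hF : DifferentiableOn ℂ F (ball 0 R)) (hF0 : F 0 = 0) :
    ∫ w in ball (0 : ℂ) R, F w = 0 := by
  rw [← integral_indicator measurableSet_ball, ← Complex.integral_comp_polarCoord_symm]
  by_cases hint : IntegrableOn (fun p : ℝ × ℝ ↦
      p.1 • (ball (0 : ℂ) R).indicator F (Complex.polarCoord.symm p)) polarCoord.target
  swap
  · exact integral_undef hint
  rw [polarCoord_target, Measure.volume_eq_prod] at hint ⊢
  rw [setIntegral_prod _ hint]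
  refine setIntegral_eq_zero_of_forall_eq_zero fun r hr ↦ ?_
  have hr : 0 < r := hr
  have hcircle : ∀ θ : ℝ, Complex.polarCoord.symm (r, θ) = circleMap 0 r θ := fun θ ↦ by
    simp [circleMap, Complex.exp_mul_I]
  simp only [hcircle]
  rw [integral_smul]
  rcases lt_or_ge r R with hrR | hrR
  · have hmem : ∀ θ : ℝ, circleMap 0 r θ ∈ ball (0 : ℂ) R := fun θ ↦ by
      simpa [abs_of_pos hr] using hrR
    simp only [indicator_of_mem (hmem _)]
    rw [integral_Ioo_eq_zero_of_differentiableOn_ball hF hF0 hr hrR, smul_zero]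
  · have hmem : ∀ θ : ℝ, circleMap 0 r θ ∉ ball (0 : ℂ) R := fun θ ↦ by
      simpa [abs_of_pos hr] using hrR
    simp only [indicator_of_notMem (hmem _)]
    simp

section Univalent

variable {G : Set ℂ} {φ : ℂ → ℂ}

theorem Set.InjOn.not_eventually_eq (hG : IsOpen G) (hinj : InjOn φ G) {z : ℂ} (hz : z ∈ G) :
    ¬ ∀ᶠ w in 𝓝 z, φ w = φ z := fun h ↦ by
  have h' : ∀ᶠ w in 𝓝[≠] z, φ w = φ z ∧ w ∈ G := nhdsWithin_le_nhds (h.and (hG.mem_nhds hz))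
  obtain ⟨w, ⟨hw, hwG⟩, hne⟩ := (h'.and self_mem_nhdsWithin).exists
  exact hne (hinj hwG hz hw)

theorem continuousAt_leftInverse_of_injOn (hG : IsOpen G) (hφ : DifferentiableOn ℂ φ G)
    (hinj : InjOn φ G) {ψ : ℂ → ℂ} (hψ : LeftInvOn ψ φ G) {z : ℂ} (hz : z ∈ G) :
    ContinuousAt ψ (φ z) := by
  have hopen : 𝓝 (φ z) ≤ map φ (𝓝 z) :=
    (hφ.analyticAt (hG.mem_nhds hz)).eventually_constant_or_nhds_le_map_nhds.resolve_left
      (hinj.not_eventually_eq hG hz)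
  rw [ContinuousAt, hψ hz]
  refine (tendsto_map'_iff.2 ?_ : Tendsto ψ (map φ (𝓝 z)) (𝓝 z)).mono_left hopen
  refine tendsto_id.congr' ?_
  filter_upwards [hG.mem_nhds hz] with w hw using (hψ hw).symm

theorem eventually_rightInverse_of_injOn (hG : IsOpen G) (hφ : DifferentiableOn ℂ φ G)
    (hinj : InjOn φ G) {ψ : ℂ → ℂ} (hψ : LeftInvOn ψ φ G) {z : ℂ} (hz : z ∈ G) :
    ∀ᶠ w in 𝓝 (φ z), ψ w ∈ G ∧ φ (ψ w) = w := by
  have hopen : 𝓝 (φ z) ≤ map φ (𝓝 z) :=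
    (hφ.analyticAt (hG.mem_nhds hz)).eventually_constant_or_nhds_le_map_nhds.resolve_left
      (hinj.not_eventually_eq hG hz)
  refine hopen ?_
  rw [mem_map]
  filter_upwards [hG.mem_nhds hz] with w hw
  simp [hψ hw, hw]

theorem differentiableAt_leftInverse_of_injOn (hG : IsOpen G) (hφ : DifferentiableOn ℂ φ G)
    (hinj : InjOn φ G) {ψ : ℂ → ℂ} (hψ : LeftInvOn ψ φ G) {z : ℂ} (hz : z ∈ G) :
    DifferentiableAt ℂ ψ (φ z) := by
  have hanal : AnalyticAt ℂ φ z := hφ.analyticAt (hG.mem_nhds hz)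
  have hcont := continuousAt_leftInverse_of_injOn hG hφ hinj hψ hz
  have hright := eventually_rightInverse_of_injOn hG hφ hinj hψ hz
  refine (Complex.analyticAt_of_differentiable_on_punctured_nhds_of_continuousAt ?_
    hcont).differentiableAt
  have hne : ∀ᶠ w in 𝓝[≠] z, deriv φ w ≠ 0 := by
    refine hanal.deriv.eventually_eq_zero_or_eventually_ne_zero.resolve_left fun h0 ↦ ?_
    obtain ⟨ε, hε, hball⟩ := Metric.eventually_nhds_iff_ball.1 (h0.and (hG.mem_nhds hz))
    refine hinj.not_eventually_eq hG hz ?_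
    filter_upwards [ball_mem_nhds z hε] with w hw
    exact (convex_ball z ε).is_const_of_fderivWithin_eq_zero (𝕜 := ℂ)
      (fun x hx ↦ (hφ.mono fun y hy ↦ (hball y hy).2) x hx)
      (fun x hx ↦ by
        rw [fderivWithin_of_isOpen isOpen_ball hx]
        ext
        simpa using (hball x hx).1) hw (mem_ball_self hε)
  rw [eventually_nhdsWithin_iff] at hne ⊢
  have htend : Tendsto ψ (𝓝 (φ z)) (𝓝 z) := by simpa [ContinuousAt, hψ hz] using hcont
  filter_upwards [htend.eventually hne, hright] with w hw ⟨hwG, hwφ⟩ hwne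
  have hψz : ψ w ≠ z := fun h ↦ hwne (by rw [mem_singleton_iff, ← h, hwφ])
  have hcw := continuousAt_leftInverse_of_injOn hG hφ hinj hψ hwG
  have hrw := eventually_rightInverse_of_injOn hG hφ hinj hψ hwG
  rw [hwφ] at hcw hrw
  exact (HasDerivAt.of_local_left_inverse hcw
    (hφ.differentiableAt (hG.mem_nhds hwG)).hasDerivAt (hw hψz)
    (hrw.mono fun y hy ↦ hy.2)).differentiableAt

theorem deriv_leftInverse_mul_deriv (hG : IsOpen G) (hφ : DifferentiableOn ℂ φ G)
    (hinj : InjOn φ G) {ψ : ℂ → ℂ} (hψ : LeftInvOn ψ φ G) {z : ℂ} (hz : z ∈ G) :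
    deriv ψ (φ z) * deriv φ z = 1 := by
  have hcomp := (differentiableAt_leftInverse_of_injOn hG hφ hinj hψ hz).hasDerivAt.comp z
    (hφ.differentiableAt (hG.mem_nhds hz)).hasDerivAt
  refine hcomp.unique ((hasDerivAt_id z).congr_of_eventuallyEq ?_)
  filter_upwards [hG.mem_nhds hz] with w hw using hψ hw

/-- The change of variables formula for a univalent function. -/
theorem integral_image_eq_integral_normSq_deriv (hG : IsOpen G) (hφ : DifferentiableOn ℂ φ G)
    (hinj : InjOn φ G) (F : ℂ → ℂ) :
    ∫ w in φ '' G, F w = ∫ z in G, (‖deriv φ z‖ ^ 2 : ℝ) • F (φ z) := by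
  rw [integral_image_eq_integral_abs_det_fderiv_smul volume hG.measurableSet
    (fun z hz ↦ ((hφ.differentiableAt
      (hG.mem_nhds hz)).hasDerivAt.hasFDerivAt.restrictScalars ℝ).hasFDerivWithinAt) hinj]
  refine setIntegral_congr_fun hG.measurableSet fun z _ ↦ ?_
  simp [ContinuousLinearMap.det, LinearMap.det_restrictScalars,
      Algebra.norm_complex_eq, Complex.normSq_eq_norm_sq]

/-- The derivative of a conformal map onto a disc is orthogonal, in the Bergman space, to the
functions that vanish at the preimage of the centre. -/
theorem integral_mul_conj_deriv_eq_zero (hG : IsOpen G) (hφ : DifferentiableOn ℂ φ G) {R : ℝ}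
    (hbij : BijOn φ G (ball 0 R)) {z₀ : ℂ} (hz₀ : z₀ ∈ G) (hφ0 : φ z₀ = 0) {g : ℂ → ℂ}
    (hg : DifferentiableOn ℂ g G) (hg0 : g z₀ = 0) :
    ∫ z in G, g z * (starRingEnd ℂ) (deriv φ z) = 0 := by
  set ψ := Function.invFunOn φ G
  have hψ : LeftInvOn ψ φ G := hbij.injOn.leftInvOn_invFunOn
  have hdiff : DifferentiableOn ℂ ψ (ball 0 R) := fun w hw ↦ by
    obtain ⟨z, hz, rfl⟩ := hbij.surjOn hw
    exact (differentiableAt_leftInverse_of_injOn hG hφ hbij.injOn hψ hz).differentiableWithinAt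
  have hmaps : MapsTo ψ (ball 0 R) G := fun w hw ↦ by
    obtain ⟨z, hz, rfl⟩ := hbij.surjOn hw
    rwa [hψ hz]
  have hψ0 : ψ 0 = z₀ := by rw [← hφ0, hψ hz₀]
  have hzero := integral_ball_eq_zero_of_differentiableOn
    (F := fun w ↦ g (ψ w) * deriv ψ w) ((hg.comp hdiff hmaps).mul (hdiff.deriv isOpen_ball))
    (by simp [hψ0, hg0])
  rw [← hbij.image_eq, integral_image_eq_integral_normSq_deriv hG hφ hbij.injOn] at hzero
  rw [← hzero]
  refine setIntegral_congr_fun hG.measurableSet fun z hz ↦ ?_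
  have hinv := deriv_leftInverse_mul_deriv hG hφ hbij.injOn hψ hz
  simp only [hψ hz, Complex.real_smul, Complex.ofReal_pow, ← Complex.mul_conj']
  linear_combination -(g z * (starRingEnd ℂ) (deriv φ z)) * hinv

end Univalent

theorem sqrt_setIntegral_norm_sq_le {G : Set ℂ} (hGb : Bornology.IsBounded G) {f : ℂ → ℂ} {δ : ℝ}
    (hδ : 0 ≤ δ) (hf : ∀ z ∈ G, ‖f z‖ ≤ δ) :
    Real.sqrt (∫ z in G, ‖f z‖ ^ 2) ≤ δ * Real.sqrt (volume.real G) := by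
  have hint : ‖∫ z in G, ‖f z‖ ^ 2‖ ≤ δ ^ 2 * volume.real G :=
    norm_setIntegral_le_of_norm_le_const hGb.measure_lt_top fun z hz ↦ by
      have := hf z hz
      simpa using by gcongr
  calc Real.sqrt (∫ z in G, ‖f z‖ ^ 2) ≤ Real.sqrt (δ ^ 2 * volume.real G) :=
        Real.sqrt_le_sqrt ((Real.le_norm_self _).trans hint)
    _ = δ * Real.sqrt (volume.real G) := by
        rw [Real.sqrt_mul (sq_nonneg δ), Real.sqrt_sq hδ]

theorem ContinuousOn.integrableOn_of_norm_le {E : Type*} [NormedAddCommGroup E]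
    {G : Set ℂ} (hG : IsOpen G) (hGb : Bornology.IsBounded G) {f : ℂ → E}
    [SecondCountableTopologyEither ℂ E] (hf : ContinuousOn f G)
    {M : ℝ} (hM : ∀ z ∈ G, ‖f z‖ ≤ M) : IntegrableOn f G :=
  ⟨hf.aestronglyMeasurable hG.measurableSet,
    .restrict_of_bounded (C := M) hGb.measure_lt_top
      (ae_restrict_of_forall_mem hG.measurableSet hM)⟩

theorem Polynomial.exists_norm_eval_le (p : Polynomial ℂ) {G : Set ℂ}
    (hGb : Bornology.IsBounded G) : ∃ M, ∀ z ∈ G, ‖p.eval z‖ ≤ M := by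
  obtain ⟨M, hM⟩ := hGb.isCompact_closure.exists_bound_of_continuousOn p.continuous.continuousOn
  exact ⟨M, fun z hz ↦ hM z (subset_closure hz)⟩

theorem Polynomial.exists_derivative_eq (p : Polynomial ℂ) (z₀ : ℂ) :
    ∃ Q : Polynomial ℂ, Q.natDegree ≤ p.natDegree + 1 ∧ Q.eval z₀ = 0 ∧ Q.derivative = p := by
  set S : Polynomial ℂ := ∑ i ∈ Finset.range (p.natDegree + 1),
    Polynomial.monomial (i + 1) (p.coeff i / (i + 1))
  refine ⟨S - Polynomial.C (S.eval z₀), ?_, by simp, ?_⟩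
  · rw [Polynomial.natDegree_sub_C]
    refine Polynomial.natDegree_sum_le_of_forall_le _ _ fun i hi ↦
      (Polynomial.natDegree_monomial_le _).trans (Finset.mem_range.1 hi)
  · conv_rhs => rw [p.as_sum_range]
    rw [Polynomial.derivative_sub, Polynomial.derivative_C, sub_zero, Polynomial.derivative_sum]
    refine Finset.sum_congr rfl fun i _ ↦ ?_
    rw [Polynomial.derivative_monomial]
    have : (i : ℂ) + 1 ≠ 0 := Nat.cast_add_one_ne_zero i
    congr 1
    push_cast
    field_simp

section Extremal

variable {G : Set ℂ} {φ : ℂ → ℂ} {R : ℝ} {z₀ : ℂ} {M : ℝ}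

/-- Pythagoras' identity in the Bergman space for the derivative of a conformal map. -/
theorem integral_norm_sq_eq_add_of_conformal (hG : IsOpen G) (hGb : Bornology.IsBounded G)
    (hφ : DifferentiableOn ℂ φ G) (hbij : BijOn φ G (ball 0 R)) (hz₀ : z₀ ∈ G) (hφ0 : φ z₀ = 0)
    (hφM : ∀ z ∈ G, ‖deriv φ z‖ ≤ M) (p : Polynomial ℂ) (hp : p.eval z₀ = deriv φ z₀) :
    ∫ z in G, ‖p.eval z‖ ^ 2 =
      (∫ z in G, ‖deriv φ z‖ ^ 2) + ∫ z in G, ‖p.eval z - deriv φ z‖ ^ 2 := by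
  obtain ⟨N, hN⟩ := p.exists_norm_eval_le hGb
  have hφ' : DifferentiableOn ℂ (deriv φ) G := hφ.deriv hG
  have hdiff : DifferentiableOn ℂ (fun z ↦ p.eval z - deriv φ z) G :=
    p.differentiable.differentiableOn.sub hφ'
  have hbound : ∀ z ∈ G, ‖p.eval z - deriv φ z‖ ≤ N + M := fun z hz ↦
    (norm_sub_le _ _).trans (add_le_add (hN z hz) (hφM z hz))
  have horth := integral_mul_conj_deriv_eq_zero hG hφ hbij hz₀ hφ0 hdiff (by simp [hp])
  have hcross : IntegrableOn
      (fun z ↦ (p.eval z - deriv φ z) * (starRingEnd ℂ) (deriv φ z)) G := by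
    refine ContinuousOn.integrableOn_of_norm_le hG hGb (M := (N + M) * M)
      (hdiff.continuousOn.mul (Complex.continuous_conj.comp_continuousOn hφ'.continuousOn))
      fun z hz ↦ ?_
    have h1 := hbound z hz
    have h2 := hφM z hz
    rw [norm_mul, RCLike.norm_conj]
    have := (norm_nonneg _).trans h1
    gcongr
  have hsq₁ : IntegrableOn (fun z ↦ ‖deriv φ z‖ ^ 2) G := by
    refine ContinuousOn.integrableOn_of_norm_le hG hGb (M := M ^ 2)
      (hφ'.continuousOn.norm.pow 2) fun z hz ↦ ?_
    have := hφM z hz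
    simpa using by gcongr
  have hsq₂ : IntegrableOn (fun z ↦ ‖p.eval z - deriv φ z‖ ^ 2) G := by
    refine ContinuousOn.integrableOn_of_norm_le hG hGb (M := (N + M) ^ 2)
      (hdiff.continuousOn.norm.pow 2) fun z hz ↦ ?_
    have := hbound z hz
    simpa using by gcongr
  have hre : ∫ z in G, ((p.eval z - deriv φ z) * (starRingEnd ℂ) (deriv φ z)).re = 0 := by
    have := integral_re (𝕜 := ℂ) hcross
    simp only [RCLike.re_to_complex] at this
    rw [this, horth, Complex.zero_re]
  have hexpand : ∀ z, ‖p.eval z‖ ^ 2 = ‖deriv φ z‖ ^ 2 + ‖p.eval z - deriv φ z‖ ^ 2 +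
      2 * ((p.eval z - deriv φ z) * (starRingEnd ℂ) (deriv φ z)).re := fun z ↦ by
    simp only [Complex.sq_norm, Complex.normSq_apply, Complex.sub_re, Complex.sub_im,
      Complex.mul_re, Complex.conj_re, Complex.conj_im]
    ring
  have hcross_re : IntegrableOn
      (fun z ↦ 2 * ((p.eval z - deriv φ z) * (starRingEnd ℂ) (deriv φ z)).re) G :=
    hcross.re.const_mul 2
  have hsq : IntegrableOn (fun z ↦ ‖deriv φ z‖ ^ 2 + ‖p.eval z - deriv φ z‖ ^ 2) G :=
    hsq₁.add hsq₂
  simp only [hexpand]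
  rw [integral_add hsq hcross_re, integral_add hsq₁ hsq₂, integral_const_mul, hre]
  ring

/-- The derivative of a Bieberbach polynomial is close in the Bergman space to that of every
competitor whose derivative approximates the derivative of the conformal map. -/
theorem IsBieberbachPoly.sqrt_integral_norm_sq_sub_le {n : ℕ} {B Q : Polynomial ℂ}
    (hB : IsBieberbachPoly G z₀ n B) (hG : IsOpen G) (hGb : Bornology.IsBounded G)
    (hφ : DifferentiableOn ℂ φ G) (hbij : BijOn φ G (ball 0 R)) (hz₀ : z₀ ∈ G) (hφ0 : φ z₀ = 0)
    (hφ1 : deriv φ z₀ = 1) (hφM : ∀ z ∈ G, ‖deriv φ z‖ ≤ M) (hQn : Q.natDegree ≤ n)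
    (hQ0 : Q.eval z₀ = 0) (hQ1 : Q.derivative.eval z₀ = 1) {δ : ℝ} (hδ : 0 ≤ δ)
    (hQδ : ∀ z ∈ G, ‖Q.derivative.eval z - deriv φ z‖ ≤ δ) :
    Real.sqrt (∫ z in G, ‖(Q - B).derivative.eval z‖ ^ 2) ≤
      2 * δ * Real.sqrt (volume.real G) := by
  obtain ⟨-, -, hB1, hmin⟩ := hB
  have hcont : ∀ p : Polynomial ℂ, ContinuousOn (fun z ↦ ‖p.eval z - deriv φ z‖ ^ 2) G :=
    fun p ↦ (p.continuous.continuousOn.sub (hφ.deriv hG).continuousOn).norm.pow 2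
  have hint : ∀ p : Polynomial ℂ, IntegrableOn (fun z ↦ ‖p.eval z - deriv φ z‖ ^ 2) G :=
    fun p ↦ by
      obtain ⟨N, hN⟩ := p.exists_norm_eval_le hGb
      refine (hcont p).integrableOn_of_norm_le hG hGb (M := (N + M) ^ 2) fun z hz ↦ ?_
      have := (norm_sub_le (p.eval z) (deriv φ z)).trans (add_le_add (hN z hz) (hφM z hz))
      simpa using by gcongr
  have hpythB := integral_norm_sq_eq_add_of_conformal hG hGb hφ hbij hz₀ hφ0 hφM B.derivative
    (hB1.trans hφ1.symm)
  have hpythQ := integral_norm_sq_eq_add_of_conformal hG hGb hφ hbij hz₀ hφ0 hφM Q.derivative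
    (hQ1.trans hφ1.symm)
  have hle : ∫ z in G, ‖B.derivative.eval z - deriv φ z‖ ^ 2 ≤
      ∫ z in G, ‖Q.derivative.eval z - deriv φ z‖ ^ 2 := by
    linarith [hmin Q hQn hQ0 hQ1]
  have hsub : ∫ z in G, ‖(Q - B).derivative.eval z‖ ^ 2 ≤
      4 * ∫ z in G, ‖Q.derivative.eval z - deriv φ z‖ ^ 2 :=
    calc ∫ z in G, ‖(Q - B).derivative.eval z‖ ^ 2
        ≤ ∫ z in G, (2 * ‖Q.derivative.eval z - deriv φ z‖ ^ 2 +
            2 * ‖B.derivative.eval z - deriv φ z‖ ^ 2) := by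
          refine integral_mono_of_nonneg (ae_of_all _ fun z ↦ sq_nonneg _)
            (((hint _).const_mul 2).add ((hint _).const_mul 2)) (ae_of_all _ fun z ↦ ?_)
          have htri : ‖(Q - B).derivative.eval z‖ ≤
              ‖Q.derivative.eval z - deriv φ z‖ + ‖B.derivative.eval z - deriv φ z‖ := by
            rw [Polynomial.derivative_sub, Polynomial.eval_sub,
              ← sub_sub_sub_cancel_right _ _ (deriv φ z)]
            exact norm_sub_le _ _
          simp only
          nlinarith [norm_nonneg ((Q - B).derivative.eval z),
            sq_nonneg (‖Q.derivative.eval z - deriv φ z‖ - ‖B.derivative.eval z - deriv φ z‖)]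
      _ ≤ 4 * ∫ z in G, ‖Q.derivative.eval z - deriv φ z‖ ^ 2 := by
          rw [integral_add ((hint _).const_mul 2) ((hint _).const_mul 2), integral_const_mul,
            integral_const_mul]
          linarith
  calc Real.sqrt (∫ z in G, ‖(Q - B).derivative.eval z‖ ^ 2)
      ≤ Real.sqrt (2 ^ 2 * ∫ z in G, ‖Q.derivative.eval z - deriv φ z‖ ^ 2) :=
        Real.sqrt_le_sqrt (by linarith)
    _ = 2 * Real.sqrt (∫ z in G, ‖Q.derivative.eval z - deriv φ z‖ ^ 2) := by
        rw [Real.sqrt_mul (by norm_num), Real.sqrt_sq (by norm_num)]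
    _ ≤ 2 * δ * Real.sqrt (volume.real G) := by
        rw [mul_assoc]
        gcongr
        exact sqrt_setIntegral_norm_sq_le hGb hδ hQδ

end Extremal

theorem tendsto_eval_of_tendstoUniformlyOn_derivative {G : Set ℂ} (hG : IsOpen G)
    (hGc : IsPreconnected G) {φ : ℂ → ℂ} (hφ : DifferentiableOn ℂ φ G) {z₀ : ℂ} (hz₀ : z₀ ∈ G)
    {Q : ℕ → Polynomial ℂ} (hQ₀ : ∀ m, (Q m).eval z₀ = φ z₀)
    (hcauchy : ∀ z ∈ G, CauchySeq fun m ↦ (Q m).eval z)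
    (hderiv : TendstoUniformlyOn (fun m z ↦ (Q m).derivative.eval z) (deriv φ) atTop G)
    {z : ℂ} (hz : z ∈ G) : Tendsto (fun m ↦ (Q m).eval z) atTop (𝓝 (φ z)) := by
  have hlim : ∀ z ∈ G, Tendsto (fun m ↦ (Q m).eval z) atTop
      (𝓝 (limUnder atTop fun m ↦ (Q m).eval z)) := fun z hz ↦ (hcauchy z hz).tendsto_limUnder
  have hg : ∀ z ∈ G, HasDerivAt (fun z ↦ limUnder atTop fun m ↦ (Q m).eval z) (deriv φ z) z :=
    fun z hz ↦ hasDerivAt_of_tendstoUniformlyOn hG hderiv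
      (Eventually.of_forall fun m x _ ↦ (Q m).hasDerivAt x) hlim hz
  have heq := hG.eqOn_of_deriv_eq hGc
    (fun z hz ↦ (hg z hz).differentiableAt.differentiableWithinAt) hφ
    (fun z hz ↦ (hg z hz).deriv) hz₀
    (tendsto_nhds_unique (hlim z₀ hz₀) (by simp [hQ₀]))
  have := hlim z hz
  rwa [show (limUnder atTop fun m ↦ (Q m).eval z) = φ z from heq hz] at this

section Rate

variable {a r : ℝ}

theorem exists_rpow_mul_exp_neg_rpow_le (ha : 0 < a) (hr : 0 < r) (s : ℝ) :
    ∃ K, 0 ≤ K ∧ ∀ m : ℕ, ((m + 1 : ℕ) : ℝ) ^ s * Real.exp (-a * ((m + 1 : ℕ) : ℝ) ^ r) ≤ K := by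
  have htend : Tendsto (fun m : ℕ ↦ ((m + 1 : ℕ) : ℝ) ^ r) atTop atTop :=
    (tendsto_rpow_atTop hr).comp (tendsto_natCast_atTop_atTop.comp (tendsto_add_atTop_nat 1))
  have hzero := (tendsto_rpow_mul_exp_neg_mul_atTop_nhds_zero (s / r) a ha).comp htend
  obtain ⟨K, hK⟩ := hzero.bddAbove_range
  have hbound : ∀ m : ℕ,
      ((m + 1 : ℕ) : ℝ) ^ s * Real.exp (-a * ((m + 1 : ℕ) : ℝ) ^ r) ≤ K := fun m ↦ by
    have := hK (mem_range_self m)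
    rwa [Function.comp_apply, ← Real.rpow_mul (by positivity), mul_div_cancel₀ _ hr.ne'] at this
  exact ⟨K, le_trans (by positivity) (hbound 0), hbound⟩

theorem exists_tsum_rpow_mul_exp_neg_rpow_le (ha : 0 < a) (hr : 0 < r) (s : ℝ) :
    ∃ K, 0 ≤ K ∧
      Summable (fun m : ℕ ↦ ((m + 1 : ℕ) : ℝ) ^ s * Real.exp (-a * ((m + 1 : ℕ) : ℝ) ^ r)) ∧
      ∀ m : ℕ, ∑' k : ℕ, ((m + k + 1 : ℕ) : ℝ) ^ s * Real.exp (-a * ((m + k + 1 : ℕ) : ℝ) ^ r) ≤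
        K * Real.exp (-(a / 2) * ((m + 1 : ℕ) : ℝ) ^ r) := by
  obtain ⟨K, hK0, hK⟩ := exists_rpow_mul_exp_neg_rpow_le (half_pos ha) hr (s + 2)
  have hsq : Summable fun m : ℕ ↦ K * (1 / ((m + 1 : ℕ) : ℝ) ^ 2) :=
    ((summable_nat_add_iff 1).2 (Real.summable_one_div_nat_pow.2 one_lt_two)).mul_left K
  have hterm : ∀ m : ℕ, ((m + 1 : ℕ) : ℝ) ^ s * Real.exp (-a * ((m + 1 : ℕ) : ℝ) ^ r) ≤
      K * (1 / ((m + 1 : ℕ) : ℝ) ^ 2) * Real.exp (-(a / 2) * ((m + 1 : ℕ) : ℝ) ^ r) := fun m ↦ by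
    have hpos : (0 : ℝ) < ((m + 1 : ℕ) : ℝ) := by positivity
    have hm := hK m
    rw [Real.rpow_add hpos, Real.rpow_two] at hm
    rw [show -a * ((m + 1 : ℕ) : ℝ) ^ r =
      -(a / 2) * ((m + 1 : ℕ) : ℝ) ^ r + -(a / 2) * ((m + 1 : ℕ) : ℝ) ^ r by ring, Real.exp_add,
      ← mul_assoc]
    refine mul_le_mul_of_nonneg_right ?_ (Real.exp_pos _).le
    rw [mul_one_div, le_div_iff₀ (by positivity)]
    linarith
  have hmono : ∀ m k : ℕ, Real.exp (-(a / 2) * ((m + k + 1 : ℕ) : ℝ) ^ r) ≤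
      Real.exp (-(a / 2) * ((m + 1 : ℕ) : ℝ) ^ r) := fun m k ↦ by
    simp only [neg_mul]
    gcongr
    omega
  have hsum : Summable fun m : ℕ ↦
      ((m + 1 : ℕ) : ℝ) ^ s * Real.exp (-a * ((m + 1 : ℕ) : ℝ) ^ r) := by
    refine Summable.of_nonneg_of_le (fun m ↦ by positivity) (fun m ↦ (hterm m).trans ?_) hsq
    refine mul_le_of_le_one_right (by positivity) (Real.exp_le_one_iff.2 ?_)
    rw [neg_mul, neg_nonpos]
    positivity
  refine ⟨∑' m : ℕ, K * (1 / ((m + 1 : ℕ) : ℝ) ^ 2), tsum_nonneg fun m ↦ by positivity, hsum,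
    fun m ↦ ?_⟩
  have hinj : Function.Injective fun k : ℕ ↦ m + k := add_right_injective m
  calc ∑' k : ℕ, ((m + k + 1 : ℕ) : ℝ) ^ s * Real.exp (-a * ((m + k + 1 : ℕ) : ℝ) ^ r)
      ≤ ∑' k : ℕ, K * (1 / ((m + k + 1 : ℕ) : ℝ) ^ 2) *
          Real.exp (-(a / 2) * ((m + 1 : ℕ) : ℝ) ^ r) := by
        refine Summable.tsum_le_tsum (fun k ↦ (hterm (m + k)).trans ?_)
          (hsum.comp_injective hinj) ((hsq.comp_injective hinj).mul_right _)
        exact mul_le_mul_of_nonneg_left (hmono m k) (by positivity)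
    _ = (∑' k : ℕ, K * (1 / ((m + k + 1 : ℕ) : ℝ) ^ 2)) *
          Real.exp (-(a / 2) * ((m + 1 : ℕ) : ℝ) ^ r) := tsum_mul_right
    _ ≤ _ := by
        refine mul_le_mul_of_nonneg_right ?_ (Real.exp_pos _).le
        exact tsum_comp_le_tsum_of_inj hsq (fun m ↦ by positivity) hinj

end Rate

/-- Admissible competitors in the Bieberbach problem whose derivatives approximate the derivative
of the conformal map at the given rate. -/
theorem exists_competitors {G : Set ℂ} {φ : ℂ → ℂ} {z₀ : ℂ} (hz₀ : z₀ ∈ G)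
    (hφ1 : deriv φ z₀ = 1) {M : ℝ} (hφM : ∀ z ∈ G, ‖deriv φ z‖ ≤ M)
    {C c r : ℝ} (hc : 0 < c) (hr0 : 0 < r) (hr1 : r ≤ 1)
    {p : ℕ → Polynomial ℂ} (happrox : ∀ n : ℕ, 1 ≤ n → (p n).natDegree ≤ n ∧ ∀ z ∈ G,
      ‖deriv φ z - (p n).eval z‖ ≤ C * Real.exp (-c * (n : ℝ) ^ r)) :
    ∃ D, 0 ≤ D ∧ ∃ Q : ℕ → Polynomial ℂ, ∀ m, (Q m).natDegree ≤ m + 1 ∧ (Q m).eval z₀ = 0 ∧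
      (Q m).derivative.eval z₀ = 1 ∧ ∀ z ∈ G, ‖(Q m).derivative.eval z - deriv φ z‖ ≤
        D * Real.exp (-c * ((m + 1 : ℕ) : ℝ) ^ r) := by
  have hM0 : 0 ≤ M := (norm_nonneg _).trans (hφM z₀ hz₀)
  have hq : ∀ m : ℕ, ∃ q : Polynomial ℂ, q.natDegree ≤ m ∧ ∀ z ∈ G,
      ‖q.eval z - deriv φ z‖ ≤ max C M * Real.exp (-c * (m : ℝ) ^ r) := fun m ↦ by
    rcases Nat.eq_zero_or_pos m with rfl | hm
    · refine ⟨0, by simp, fun z hz ↦ ?_⟩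
      simpa [Real.zero_rpow hr0.ne'] using Or.inr (hφM z hz)
    · refine ⟨p m, (happrox m hm).1, fun z hz ↦ ?_⟩
      rw [norm_sub_rev]
      refine ((happrox m hm).2 z hz).trans ?_
      gcongr
      exact le_max_left _ _
  choose q hqdeg hqapprox using hq
  have hexists : ∀ m : ℕ, ∃ Q : Polynomial ℂ, Q.natDegree ≤ m + 1 ∧ Q.eval z₀ = 0 ∧
      Q.derivative = q m + Polynomial.C (1 - (q m).eval z₀) := fun m ↦ by
    obtain ⟨Q, hdeg, h0, hder⟩ :=
      (q m + Polynomial.C (1 - (q m).eval z₀)).exists_derivative_eq z₀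
    rw [Polynomial.natDegree_add_C] at hdeg
    exact ⟨Q, hdeg.trans (by have := hqdeg m; omega), h0, hder⟩
  choose Q hQdeg hQ0 hQder using hexists
  refine ⟨2 * max C M * Real.exp c, by positivity, Q, fun m ↦
    ⟨hQdeg m, hQ0 m, by simp [hQder], fun z hz ↦ ?_⟩⟩
  have hshift : Real.exp (-c * (m : ℝ) ^ r) ≤
      Real.exp c * Real.exp (-c * ((m + 1 : ℕ) : ℝ) ^ r) := by
    rw [← Real.exp_add]
    gcongr
    have := Real.rpow_add_le_add_rpow (Nat.cast_nonneg (α := ℝ) m) zero_le_one hr0.le hr1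
    rw [Real.one_rpow] at this
    push_cast
    nlinarith
  have hnorm : (Q m).derivative.eval z - deriv φ z =
      ((q m).eval z - deriv φ z) - ((q m).eval z₀ - deriv φ z₀) := by
    rw [hQder, hφ1]
    simp
    ring
  calc ‖(Q m).derivative.eval z - deriv φ z‖
      ≤ ‖(q m).eval z - deriv φ z‖ + ‖(q m).eval z₀ - deriv φ z₀‖ := by
        rw [hnorm]
        exact norm_sub_le _ _
    _ ≤ 2 * max C M * Real.exp (-c * (m : ℝ) ^ r) := by
        linarith [hqapprox m z hz, hqapprox m z₀ hz₀]
    _ ≤ 2 * max C M * (Real.exp c * Real.exp (-c * ((m + 1 : ℕ) : ℝ) ^ r)) := by gcongr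
    _ = _ := by ring

/-- **Abstract form of Theorem 1.** If `φ'` admits polynomial approximation at
rate `C exp(−c n^r)` in the uniform norm on `G`, and the polynomial inequality
`sup_G |Q| ≤ A n^{P−1} (∫∫_G |Q'|²)^{1/2}` holds for polynomials of degree at
most `n` vanishing at `z₀`, then the Bieberbach polynomials converge uniformly
on `G` at the rate `C' q^{n^{r'}}`. -/
theorem bieberbach_poly_uniform_convergence_rate
    (G : Set ℂ) (hG : IsJordanDomain G) (z₀ : ℂ) (hz₀ : z₀ ∈ G)
    (R₀ : ℝ) (hR₀ : 0 < R₀) (φ : ℂ → ℂ)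
    (hφdiff : DifferentiableOn ℂ φ G)
    (hφbij : Set.BijOn φ G (Metric.ball (0 : ℂ) R₀))
    (hφ0 : φ z₀ = 0) (hφ1 : deriv φ z₀ = 1)
    (B : ℕ → Polynomial ℂ) (hB : ∀ n, 1 ≤ n → IsBieberbachPoly G z₀ n (B n))
    (C c r : ℝ) (hC : 0 < C) (hc : 0 < c) (hr0 : 0 < r) (hr1 : r < 1)
    (p : ℕ → Polynomial ℂ)
    (happrox : ∀ n : ℕ, 1 ≤ n → (p n).natDegree ≤ n ∧ ∀ z ∈ G,
      ‖deriv φ z - (p n).eval z‖ ≤ C * Real.exp (-c * (n : ℝ) ^ r))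
    (A P : ℝ) (hA : 0 < A) (hP : 1 ≤ P)
    (hpoly : ∀ n : ℕ, 1 ≤ n → ∀ Q : Polynomial ℂ, Q.natDegree ≤ n →
      Q.eval z₀ = 0 → ∀ z ∈ G,
        ‖Q.eval z‖ ≤ A * (n : ℝ) ^ (P - 1) *
          Real.sqrt (∫ w in G, ‖Q.derivative.eval w‖ ^ 2)) :
    ∃ C' q r' : ℝ, 0 < C' ∧ 0 < q ∧ q < 1 ∧ 0 < r' ∧ r' < 1 ∧
      ∀ n : ℕ, 1 ≤ n → ∀ z ∈ G,
        ‖φ z - (B n).eval z‖ ≤ C' * q ^ ((n : ℝ) ^ r') := by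

  obtain ⟨hGo, hGb, hsc, -⟩ := hG
  have hGc : IsPreconnected G := isPreconnected_iff_preconnectedSpace.2 inferInstance
  obtain ⟨N, hN⟩ := (p 1).exists_norm_eval_le hGb
  have hφM : ∀ z ∈ G, ‖deriv φ z‖ ≤ C * Real.exp (-c * ((1 : ℕ) : ℝ) ^ r) + N := fun z hz ↦
    calc ‖deriv φ z‖ = ‖(deriv φ z - (p 1).eval z) + (p 1).eval z‖ := by rw [sub_add_cancel]
      _ ≤ _ := (norm_add_le _ _).trans (add_le_add ((happrox 1 le_rfl).2 z hz) (hN z hz))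
  obtain ⟨D, hD, Q, hQ⟩ := exists_competitors hz₀ hφ1 hφM hc hr0 hr1.le happrox
  obtain ⟨K, hK, hsum, htail⟩ := exists_tsum_rpow_mul_exp_neg_rpow_le hc hr0 (P - 1)
  set d : ℕ → ℝ := fun m ↦
    ((m + 1 : ℕ) : ℝ) ^ (P - 1) * Real.exp (-c * ((m + 1 : ℕ) : ℝ) ^ r) with hd
  have hd0 : ∀ m, 0 ≤ d m := fun m ↦ by positivity
  set V := Real.sqrt (volume.real G)
  have hV : 0 ≤ V := Real.sqrt_nonneg _
  set L := A * 2 ^ (P - 1) * (2 * D) * V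
  have hL : 0 ≤ L := by positivity
  have hstep : ∀ z ∈ G, ∀ m, dist ((Q m).eval z) ((Q (m + 1)).eval z) ≤ L * d m :=
    fun z hz m ↦ by
      obtain ⟨hdeg, h0, -, happ⟩ := hQ m
      obtain ⟨hdeg', h0', -, happ'⟩ := hQ (m + 1)
      have hder : ∀ w ∈ G, ‖(Q m - Q (m + 1)).derivative.eval w‖ ≤
          2 * D * Real.exp (-c * ((m + 1 : ℕ) : ℝ) ^ r) := fun w hw ↦ by
        have hmono : D * Real.exp (-c * ((m + 1 + 1 : ℕ) : ℝ) ^ r) ≤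
            D * Real.exp (-c * ((m + 1 : ℕ) : ℝ) ^ r) := by
          simp only [neg_mul]
          gcongr
          omega
        rw [Polynomial.derivative_sub, Polynomial.eval_sub,
          ← sub_sub_sub_cancel_right _ _ (deriv φ w)]
        linarith [norm_sub_le ((Q m).derivative.eval w - deriv φ w)
          ((Q (m + 1)).derivative.eval w - deriv φ w), happ w hw, happ' w hw]
      have hbound := hpoly (m + 2) (by omega) (Q m - Q (m + 1))
        ((Polynomial.natDegree_sub_le _ _).trans (by omega)) (by simp [h0, h0']) z hz
      have hpow : ((m + 2 : ℕ) : ℝ) ^ (P - 1) ≤ 2 ^ (P - 1) * ((m + 1 : ℕ) : ℝ) ^ (P - 1) := by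
        rw [← Real.mul_rpow (by norm_num) (by positivity)]
        refine Real.rpow_le_rpow (by positivity) ?_ (by linarith)
        push_cast
        linarith [Nat.cast_nonneg (α := ℝ) m]
      rw [dist_eq_norm, ← Polynomial.eval_sub]
      calc ‖(Q m - Q (m + 1)).eval z‖
          ≤ A * ((m + 2 : ℕ) : ℝ) ^ (P - 1) *
              Real.sqrt (∫ w in G, ‖(Q m - Q (m + 1)).derivative.eval w‖ ^ 2) := hbound
        _ ≤ A * (2 ^ (P - 1) * ((m + 1 : ℕ) : ℝ) ^ (P - 1)) *
              (2 * D * Real.exp (-c * ((m + 1 : ℕ) : ℝ) ^ r) * V) := by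
            gcongr
            exact sqrt_setIntegral_norm_sq_le hGb (by positivity) hder
        _ = L * d m := by simp only [L, hd]; ring
  have hB_near : ∀ z ∈ G, ∀ m, dist ((Q m).eval z) ((B (m + 1)).eval z) ≤
      A * (2 * D) * V * d m := fun z hz m ↦ by
    obtain ⟨hdeg, h0, h1, happ⟩ := hQ m
    have hBm := hB (m + 1) (by omega)
    rw [dist_eq_norm, ← Polynomial.eval_sub]
    calc ‖(Q m - B (m + 1)).eval z‖
        ≤ A * ((m + 1 : ℕ) : ℝ) ^ (P - 1) *
            Real.sqrt (∫ w in G, ‖(Q m - B (m + 1)).derivative.eval w‖ ^ 2) :=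
          hpoly (m + 1) (by omega) _
            ((Polynomial.natDegree_sub_le _ _).trans (max_le hdeg hBm.1))
            (by simp [h0, hBm.2.1]) z hz
      _ ≤ A * ((m + 1 : ℕ) : ℝ) ^ (P - 1) *
            (2 * (D * Real.exp (-c * ((m + 1 : ℕ) : ℝ) ^ r)) * V) := by
          gcongr
          exact hBm.sqrt_integral_norm_sq_sub_le hGo hGb hφdiff hφbij hz₀ hφ0 hφ1 hφM hdeg h0 h1
            (by positivity) happ
      _ = A * (2 * D) * V * d m := by simp only [hd]; ring
  have hsumL : Summable fun m ↦ L * d m := hsum.mul_left L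
  have hderiv : TendstoUniformlyOn (fun m z ↦ (Q m).derivative.eval z) (deriv φ) atTop G := by
    have hzero : Tendsto (fun m ↦ D * d m) atTop (𝓝 0) := by
      simpa using hsum.tendsto_atTop_zero.const_mul D
    rw [Metric.tendstoUniformlyOn_iff]
    intro ε hε
    filter_upwards [hzero.eventually_lt_const hε] with m hm z hz
    rw [dist_comm, dist_eq_norm]
    refine ((hQ m).2.2.2 z hz).trans_lt (lt_of_le_of_lt ?_ hm)
    gcongr
    refine le_mul_of_one_le_left (Real.exp_pos _).le (Real.one_le_rpow ?_ (by linarith))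
    push_cast
    linarith [Nat.cast_nonneg (α := ℝ) m]
  have hlim : ∀ z ∈ G, Tendsto (fun m ↦ (Q m).eval z) atTop (𝓝 (φ z)) := fun z hz ↦
    tendsto_eval_of_tendstoUniformlyOn_derivative hGo hGc hφdiff hz₀
      (fun m ↦ (hQ m).2.1.trans hφ0.symm)
      (fun z hz ↦ cauchySeq_of_dist_le_of_summable _ (hstep z hz) hsumL) hderiv hz
  have hd_le : ∀ m, d m ≤ K * Real.exp (-(c / 2) * ((m + 1 : ℕ) : ℝ) ^ r) := fun m ↦
    le_trans ((hsum.comp_injective (add_right_injective m)).le_tsum 0 fun k _ ↦ hd0 _) (htail m)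
  have hfinal : ∀ z ∈ G, ∀ m, ‖φ z - (B (m + 1)).eval z‖ ≤
      (L + A * (2 * D) * V) * K * Real.exp (-(c / 2) * ((m + 1 : ℕ) : ℝ) ^ r) := fun z hz m ↦ by
    have hQφ := dist_le_tsum_of_dist_le_of_tendsto _ (hstep z hz) hsumL (hlim z hz) m
    rw [tsum_mul_left] at hQφ
    have hQφ' := hQφ.trans (mul_le_mul_of_nonneg_left (htail m) hL)
    have hQB := (hB_near z hz m).trans
      (mul_le_mul_of_nonneg_left (hd_le m) (by positivity : 0 ≤ A * (2 * D) * V))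
    rw [← dist_eq_norm]
    linarith [dist_triangle_left (φ z) ((B (m + 1)).eval z) ((Q m).eval z)]
  refine ⟨(L + A * (2 * D) * V) * K + 1, Real.exp (-(c / 2)), r, by positivity, Real.exp_pos _,
    Real.exp_lt_one_iff.2 (by linarith), hr0, hr1, fun n hn z hz ↦ ?_⟩
  obtain ⟨m, rfl⟩ := Nat.exists_eq_add_of_le' hn
  rw [← Real.exp_mul]
  refine (hfinal z hz m).trans ?_
  gcongr
  linarith
end

section
/- Let G ⊂ ℂ be a bounded open set of positive two-dimensional Lebesgue measure that is symmetric with respect to the real axis (invariant under complex conjugation), and let ξ ∈ ℝ be such that G ⊆ {z : Re z < ξ}. Then the area orthonormal polynomials of G satisfy K_n(x) > 0 for every real x > ξ and every n ≥ 0. -/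
open MeasureTheory Filter

/-- The area orthonormal polynomials of `G`: `K n` has exact degree `n`,
positive leading coefficient, and `∫∫_G K_m conj(K_n) = δ_{mn}`. -/
def AreaOrthonormalPolys (G : Set ℂ) (K : ℕ → Polynomial ℂ) : Prop :=
  (∀ n, (K n).natDegree = n) ∧
  (∀ n, ∃ a : ℝ, 0 < a ∧ (K n).leadingCoeff = (a : ℂ)) ∧
  (∀ m n, (∫ z in G, (K m).eval z * (starRingEnd ℂ) ((K n).eval z)) =
      if m = n then (1 : ℂ) else 0)

open Polynomial in
theorem eval_map_conj (p : ℂ[X]) (z : ℂ) :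
    (p.map (starRingEnd ℂ)).eval z = (starRingEnd ℂ) (p.eval ((starRingEnd ℂ) z)) := by
  have h := eval₂_at_apply (p := p) (starRingEnd ℂ) ((starRingEnd ℂ) z)
  rwa [Complex.conj_conj, ← eval_map] at h

theorem Continuous.integrableOn_of_isBounded {E : Type*} [NormedAddCommGroup E] {f : ℂ → E}
    (hf : Continuous f) {G : Set ℂ} (hG : Bornology.IsBounded G) : IntegrableOn f G :=
  (hf.continuousOn.integrableOn_compact hG.isCompact_closure).mono_set subset_closure

open Polynomial in
theorem integrableOn_eval_mul_conj_eval {G : Set ℂ} (hG : Bornology.IsBounded G) (p q : ℂ[X]) :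
    IntegrableOn (fun z => p.eval z * (starRingEnd ℂ) (q.eval z)) G :=
  Continuous.integrableOn_of_isBounded
    (p.continuous.mul (Complex.continuous_conj.comp q.continuous)) hG

open Polynomial in
theorem setIntegral_mul_normSq_eval_pos {G : Set ℂ} (hGopen : IsOpen G)
    (hGbdd : Bornology.IsBounded G) (hGpos : 0 < volume G) {g : ℂ → ℝ} (hg : Continuous g)
    (hgpos : ∀ z ∈ G, 0 < g z) {q : ℂ[X]} (hq : q ≠ 0) :
    0 < ∫ z in G, g z * Complex.normSq (q.eval z) := by
  have hint : IntegrableOn (fun z => g z * Complex.normSq (q.eval z)) G :=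
    Continuous.integrableOn_of_isBounded
      (hg.mul (Complex.continuous_normSq.comp q.continuous)) hGbdd
  have hnn : ∀ᵐ z ∂volume.restrict G, 0 ≤ g z * Complex.normSq (q.eval z) :=
    (ae_restrict_iff' hGopen.measurableSet).2 <| Eventually.of_forall fun z hz =>
      mul_nonneg (hgpos z hz).le (Complex.normSq_nonneg _)
  rw [setIntegral_pos_iff_support_of_nonneg_ae hnn hint]
  have hfin : volume {z : ℂ | q.IsRoot z} = 0 := (finite_setOfPred_isRoot hq).measure_zero _
  refine hGpos.trans_le ?_
  rw [← measure_sdiff_null hfin]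
  refine measure_mono fun z hz => ⟨?_, hz.1⟩
  exact mul_ne_zero (hgpos z hz.1).ne' (fun h => hz.2 (Complex.normSq_eq_zero.1 h))

open Polynomial in
theorem setIntegral_conj_eval_map_conj {G : Set ℂ}
    (hsym : ∀ z : ℂ, z ∈ G ↔ (starRingEnd ℂ) z ∈ G) (p q : ℂ[X]) :
    (∫ z in G, (p.map (starRingEnd ℂ)).eval z *
        (starRingEnd ℂ) ((q.map (starRingEnd ℂ)).eval z)) =
      (starRingEnd ℂ) (∫ z in G, p.eval z * (starRingEnd ℂ) (q.eval z)) := by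
  have hpre : Complex.conjLIE ⁻¹' G = G := by
    ext z
    exact (hsym z).symm
  have h := Complex.conjLIE.measurePreserving.setIntegral_preimage_emb
    Complex.conjLIE.toHomeomorph.measurableEmbedding
    (fun z => (starRingEnd ℂ) (p.eval z * (starRingEnd ℂ) (q.eval z))) G
  rw [hpre] at h
  rw [← integral_conj, ← h]
  simp [eval_map_conj]

namespace AreaOrthonormalPolys

open Polynomial

variable {G : Set ℂ} {K : ℕ → ℂ[X]}

theorem leadingCoeff_ne_zero (hK : AreaOrthonormalPolys G K) (n : ℕ) :
    (K n).leadingCoeff ≠ 0 := by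
  obtain ⟨a, ha, h⟩ := hK.2.1 n
  rw [h]
  exact_mod_cast ha.ne'

theorem ne_zero (hK : AreaOrthonormalPolys G K) (n : ℕ) : K n ≠ 0 :=
  Polynomial.leadingCoeff_ne_zero.1 (hK.leadingCoeff_ne_zero n)

theorem degree_eq (hK : AreaOrthonormalPolys G K) (n : ℕ) : (K n).degree = n := by
  rw [degree_eq_natDegree (hK.ne_zero n), hK.1 n]

theorem setIntegral_eq_zero_of_degree_lt (hK : AreaOrthonormalPolys G K)
    (hG : Bornology.IsBounded G) (n : ℕ) (q : ℂ[X]) (hq : q.degree < n) :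
    ∫ z in G, q.eval z * (starRingEnd ℂ) ((K n).eval z) = 0 := by
  induction hd : q.degree using WellFoundedLT.induction generalizing q with
  | ind d ih =>
    by_cases h0 : q = 0
    · simp [h0]
    set m := q.natDegree with hm
    have hqm : q.degree = m := degree_eq_natDegree h0
    set c := q.leadingCoeff / (K m).leadingCoeff with hc
    have hc0 : c ≠ 0 :=
      div_ne_zero (Polynomial.leadingCoeff_ne_zero.2 h0) (hK.leadingCoeff_ne_zero m)
    set r := q - C c * K m with hr
    have hrd : r.degree < q.degree := by
      refine degree_sub_lt_left ?_ h0 ?_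
      · rw [degree_C_mul hc0, hK.degree_eq, hqm]
      · rw [leadingCoeff_mul, leadingCoeff_C, hc, div_mul_cancel₀ _ (hK.leadingCoeff_ne_zero m)]
    have hr0 := ih r.degree (hd ▸ hrd) r (hrd.trans hq) rfl
    have hmn : m ≠ n := by
      rintro h
      rw [hqm, h] at hq
      exact lt_irrefl _ hq
    have hKm := hK.2.2 m n
    rw [if_neg hmn] at hKm
    have hsplit : ∀ z, q.eval z * (starRingEnd ℂ) ((K n).eval z) =
        r.eval z * (starRingEnd ℂ) ((K n).eval z) +
          c * ((K m).eval z * (starRingEnd ℂ) ((K n).eval z)) := by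
      intro z
      simp only [hr, eval_sub, eval_mul, eval_C]
      ring
    simp_rw [hsplit]
    rw [integral_add (integrableOn_eval_mul_conj_eval hG _ _)
      ((integrableOn_eval_mul_conj_eval hG _ _).const_mul c), integral_const_mul, hr0, hKm]
    simp

theorem map_conj_eq (hK : AreaOrthonormalPolys G K) (hGopen : IsOpen G)
    (hGbdd : Bornology.IsBounded G) (hGpos : 0 < volume G)
    (hsym : ∀ z : ℂ, z ∈ G ↔ (starRingEnd ℂ) z ∈ G) (n : ℕ) :
    (K n).map (starRingEnd ℂ) = K n := by
  by_contra hne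
  set D := (K n).map (starRingEnd ℂ) - K n with hD
  have hD0 : D ≠ 0 := sub_ne_zero.2 hne
  have hdeg : D.degree < n := by
    have hmap : (K n).map (starRingEnd ℂ) ≠ 0 := by
      simpa using hK.ne_zero n
    rw [← hK.degree_eq n, ← degree_map (K n) (starRingEnd ℂ)]
    refine degree_sub_lt_left (degree_map _ _) hmap ?_
    obtain ⟨a, -, h⟩ := hK.2.1 n
    rw [leadingCoeff_map, h, Complex.conj_ofReal]
  have h1 := hK.setIntegral_eq_zero_of_degree_lt hGbdd n D hdeg
  have h2 := setIntegral_conj_eval_map_conj hsym (D.map (starRingEnd ℂ)) (K n)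
  rw [hK.setIntegral_eq_zero_of_degree_lt hGbdd n _ (by rwa [degree_map]), map_zero,
    Polynomial.map_map] at h2
  have hid : (starRingEnd ℂ).comp (starRingEnd ℂ) = RingHom.id ℂ := by
    ext z
    simp
  rw [hid, Polynomial.map_id] at h2
  have h3 : ∫ z in G, D.eval z * (starRingEnd ℂ) (D.eval z) = 0 := by
    have hsplit : ∀ z, D.eval z * (starRingEnd ℂ) (D.eval z) =
        D.eval z * (starRingEnd ℂ) (((K n).map (starRingEnd ℂ)).eval z) -
          D.eval z * (starRingEnd ℂ) ((K n).eval z) := by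
      intro z
      rw [← mul_sub, ← map_sub, hD, eval_sub]
    simp_rw [hsplit]
    rw [integral_sub (integrableOn_eval_mul_conj_eval hGbdd _ _)
      (integrableOn_eval_mul_conj_eval hGbdd _ _), h1, h2, sub_zero]
  have hpos := setIntegral_mul_normSq_eval_pos hGopen hGbdd hGpos
    (g := fun _ => 1) continuous_const (fun _ _ => one_pos) hD0
  simp_rw [Complex.mul_conj, integral_complex_ofReal] at h3
  simp only [one_mul] at hpos
  exact hpos.ne' (by exact_mod_cast h3)

theorem re_lt_of_isRoot (hK : AreaOrthonormalPolys G K) (hGopen : IsOpen G)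
    (hGbdd : Bornology.IsBounded G) (hGpos : 0 < volume G) {ξ : ℝ}
    (hξ : G ⊆ {z : ℂ | z.re < ξ}) {n : ℕ} {w : ℂ} (hw : (K n).IsRoot w) : w.re < ξ := by
  by_contra! hle
  obtain ⟨q, hq⟩ := dvd_iff_isRoot.2 hw
  have hq0 : q ≠ 0 := by
    rintro rfl
    exact hK.ne_zero n (by simpa using hq)
  have hdeg : q.degree < n := by
    rw [← hK.degree_eq n, hq, degree_mul, degree_X_sub_C, degree_eq_natDegree hq0]
    norm_cast
    omega
  have h := hK.setIntegral_eq_zero_of_degree_lt hGbdd n q hdeg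
  have hpos := setIntegral_mul_normSq_eval_pos hGopen hGbdd hGpos
    (g := fun z => w.re - z.re) (by fun_prop)
    (fun z hz => sub_pos.2 ((hξ hz).trans_le hle)) hq0
  have hre : ∀ z : ℂ, (w.re - z.re) * Complex.normSq (q.eval z) =
      -(q.eval z * (starRingEnd ℂ) ((K n).eval z)).re := by
    intro z
    rw [hq, eval_mul, map_mul, mul_left_comm, Complex.mul_conj]
    simp
    ring
  simp_rw [hre] at hpos
  have hint := integral_re (𝕜 := ℂ) (integrableOn_eval_mul_conj_eval hGbdd q (K n))
  simp only [RCLike.re_eq_complex_re] at hint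
  rw [integral_neg, hint, h] at hpos
  simp at hpos

end AreaOrthonormalPolys

open Polynomial in
/-- A real polynomial with positive leading coefficient and no zeros on `(ξ, ∞)` is positive
there. -/
theorem Polynomial.eval_pos_of_leadingCoeff_pos_of_no_root {P : ℝ[X]} (hP : 0 < P.leadingCoeff)
    {ξ : ℝ} (hroot : ∀ x, ξ < x → P.eval x ≠ 0) {x : ℝ} (hx : ξ < x) : 0 < P.eval x := by
  by_contra! hle
  obtain ⟨y, hy, hxy⟩ : ∃ y, 0 < P.eval y ∧ x ≤ y := by
    rcases Nat.eq_zero_or_pos P.natDegree with h | h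
    · rw [eq_C_of_natDegree_eq_zero h] at hP
      refine ⟨x, ?_, le_rfl⟩
      rw [eq_C_of_natDegree_eq_zero h]
      simpa using hP
    · have ht := P.tendsto_atTop_of_leadingCoeff_nonneg (natDegree_pos_iff_degree_pos.1 h) hP.le
      exact ((ht.eventually_gt_atTop 0).and (eventually_ge_atTop x)).exists
  obtain ⟨c, hc, hc0⟩ := intermediate_value_Icc hxy P.continuous.continuousOn ⟨hle, hy.le⟩
  exact hroot c (hx.trans_le hc.1) hc0

/-- For a bounded open set of positive area, symmetric in the real axis and
contained in the half-plane `{Re z < ξ}`, the area orthonormal polynomials are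
positive (real) at every real point `x > ξ`. -/
theorem orthonormal_polys_pos_right_of_halfplane
    (G : Set ℂ) (hGopen : IsOpen G) (hGbdd : Bornology.IsBounded G)
    (hGpos : 0 < volume G)
    (hsym : ∀ z : ℂ, z ∈ G ↔ (starRingEnd ℂ) z ∈ G)
    (ξ : ℝ) (hξ : G ⊆ {z : ℂ | z.re < ξ})
    (K : ℕ → Polynomial ℂ) (hK : AreaOrthonormalPolys G K) :
    ∀ n : ℕ, ∀ x : ℝ, ξ < x →
      ∃ a : ℝ, 0 < a ∧ (K n).eval (x : ℂ) = (a : ℂ) := by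
  intro n x hx
  have hconj := hK.map_conj_eq hGopen hGbdd hGpos hsym n
  obtain ⟨P, hP⟩ : ∃ P : Polynomial ℝ, P.map Complex.ofRealHom = K n := by
    rw [← Polynomial.mem_lifts, Polynomial.lifts_iff_coeff_lifts]
    intro k
    have hk := congrArg (fun p => Polynomial.coeff p k) hconj
    rw [Polynomial.coeff_map] at hk
    obtain ⟨r, hr⟩ := Complex.conj_eq_iff_real.1 hk
    exact ⟨r, hr.symm⟩
  have heval : ∀ y : ℝ, (K n).eval (y : ℂ) = ((P.eval y : ℝ) : ℂ) := by
    intro y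
    rw [← hP, Polynomial.eval_map]
    exact Polynomial.eval₂_at_apply Complex.ofRealHom y
  refine ⟨P.eval x, Polynomial.eval_pos_of_leadingCoeff_pos_of_no_root ?_ ?_ hx, heval x⟩
  · obtain ⟨a, ha, h⟩ := hK.2.1 n
    rw [← hP, Polynomial.leadingCoeff_map] at h
    have hPa : P.leadingCoeff = a := Complex.ofReal_injective h
    rwa [hPa]
  · intro y hy h0
    have hroot : (K n).IsRoot (y : ℂ) := by
      rw [Polynomial.IsRoot, heval, h0, Complex.ofReal_zero]
    exact lt_asymm hy (hK.re_lt_of_isRoot hGopen hGbdd hGpos hξ hroot)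
end
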